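/- arXiv:1407.1700 — 2 statements merged into one kernel-verified Lean document; each statement's English description precedes it below -/
import Mathlib

section
/- Let X be a Polish space, μ a Radon point measure on X and q ∈ (0,1). The independent q-thinning T^μ_q of μ (the point process obtained from μ by keeping each point of μ independently with probability q, i.e. T^μ_q = ∗_{x∈μ} ((1−q)δ_0 + q δ_{δ_x})^{∗μ({x})}) admits the Papangelou kernel π(κ, dx) = (q/(1−q)) (μ − κ)(dx) for κ ∈ M··(X); that is, for every non-negative measurable function h on X × M··(X), the Campbell measure satisfies ∫∫ h(x, κ) κ(dx) T^μ_q(dκ) = ∫∫ h(x, κ + δ_x) (q/(1−q)) (μ − κ)(dx) T^μ_q(dκ). (Note T^μ_q realizes only subconfigurations of μ, so μ − κ is T^μ_q-a.s. a Radon point measure.) -/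
open MeasureTheory ENNReal

noncomputable section

namespace PoissonSplitting

variable {X : Type*} [MeasurableSpace X] [MetricSpace X]

/-- `expNeg a = e^{-a}` for an extended nonnegative real `a`. -/
def expNeg (a : ℝ≥0∞) : ℝ≥0∞ := if a = ∞ then 0 else ENNReal.ofReal (Real.exp (-a.toReal))

/-- A (Radon) point measure on `X`: a locally finite countable sum of Dirac measures. -/
def IsPointMeasure (μ : Measure X) : Prop :=
  (∃ D : ℕ → Option X, μ = Measure.sum fun n => (D n).elim 0 Measure.dirac) ∧
    IsLocallyFiniteMeasure μ

/-- The class `U` of nonnegative bounded measurable functions on `X` whose support is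
contained in some bounded set. -/
def MemU (f : X → ℝ) : Prop :=
  Measurable f ∧ (∀ x, 0 ≤ f x) ∧ (∃ C, ∀ x, f x ≤ C) ∧
    Bornology.IsBounded (Function.support f)

/-- The pairing `ζ_f(ν) = ν(f)`, as an extended nonnegative real. -/
def pairing (f : X → ℝ) (ν : Measure X) : ℝ≥0∞ := ∫⁻ x, ENNReal.ofReal (f x) ∂ν

/-- The Laplace transform of a law `P` on measures: `L_P(f) = ∫ e^{-ν(f)} P(dν)`. -/
def laplaceT (P : Measure (Measure X)) (f : X → ℝ) : ℝ≥0∞ := ∫⁻ ν, expNeg (pairing f ν) ∂P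

/-- `T` is the independent `q`-thinning `T^μ_q` of the point measure `μ`:
the probability law, supported on point-measure subconfigurations of `μ`, whose Laplace
transform on test functions `f ∈ U` is
`T(e^{-ζ_f}) = ∏_{x∈μ}(1-q+q e^{-f(x)})^{μ({x})} = exp(∫ log(1-q+q e^{-f}) dμ)`. -/
def IsThinning (q : ℝ) (μ : Measure X) (T : Measure (Measure X)) : Prop :=
  IsProbabilityMeasure T ∧ (∀ᵐ ν ∂T, IsPointMeasure ν ∧ ν ≤ μ) ∧
    ∀ f : X → ℝ, MemU f →
      laplaceT T f =
        expNeg (∫⁻ x, ENNReal.ofReal (-Real.log (1 - q + q * Real.exp (-f x))) ∂μ)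

/-- `P` is the Poisson point process `Π_ϱ` with intensity (first moment) measure `ϱ`:
the point process with Laplace transform `L_P(f) = exp(-ϱ(1 - e^{-f}))`, `f ∈ U`. -/
def IsPoissonPP (ϱ : Measure X) (P : Measure (Measure X)) : Prop :=
  IsProbabilityMeasure P ∧ (∀ᵐ μ ∂P, IsPointMeasure μ) ∧
    ∀ f : X → ℝ, MemU f →
      laplaceT P f = expNeg (∫⁻ x, ENNReal.ofReal (1 - Real.exp (-f x)) ∂ϱ)

/-- A point process: a probability law on the point measures of `X`. -/
def IsPointProcess (P : Measure (Measure X)) : Prop :=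
  IsProbabilityMeasure P ∧ ∀ᵐ μ ∂P, IsPointMeasure μ

/-- The first moment (intensity) measure `ν_P` of a point process `P`:
`ν_P(B) = ∫ μ(B) P(dμ)`. -/
def momentMeasure (P : Measure (Measure X)) : Measure X := P.bind id

/-- `P` is of first order if its first moment measure is a Radon (locally finite) measure. -/
def IsFirstOrder (P : Measure (Measure X)) : Prop := IsLocallyFiniteMeasure (momentMeasure P)

end PoissonSplitting

open MeasureTheory ENNReal PoissonSplitting


open scoped NNReal BoundedContinuousFunction

theorem aux_core {Ω : Type*} [MeasurableSpace Ω] (T : Measure Ω) [IsProbabilityMeasure T]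
    (q : ℝ) (hq : q ∈ Set.Ioo (0 : ℝ) 1) (N R : Ω → ℝ) (hN : Measurable N) (hR : Measurable R)
    (m K : ℝ) (hN0 : ∀ ω, 0 ≤ N ω) (hNm : ∀ᵐ ω ∂T, N ω ≤ m) (hR0 : ∀ ω, 0 ≤ R ω)
    (hE : ∀ t : ℝ, 0 ≤ t → ∫ ω, Real.exp (-(t * N ω + R ω)) ∂T
      = Real.exp (m * Real.log (1 - q + q * Real.exp (-t)) + K)) (t : ℝ) (ht : 0 ≤ t) :
    ∫ ω, N ω * Real.exp (-(t * N ω + R ω)) ∂T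
      = ∫ ω, (q / (1 - q) * (m - N ω)) * Real.exp (-(t * (N ω + 1) + R ω)) ∂T := by
  obtain ⟨hq0, hq1⟩ := hq
  have hm : 0 ≤ m := by
    obtain ⟨ω, hω⟩ := hNm.exists
    exact (hN0 ω).trans hω
  have hint : Integrable (fun ω => Real.exp (-(t * N ω + R ω))) T := by
    refine Integrable.of_bound (C := 1) (by fun_prop) (Filter.Eventually.of_forall fun ω => ?_)
    rw [Real.norm_of_nonneg (Real.exp_pos _).le, Real.exp_le_one_iff]
    have := mul_nonneg ht (hN0 ω); have := hR0 ω; linarith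
  have hder := hasDerivAt_integral_of_dominated_loc_of_deriv_le (μ := T)
    (F := fun t ω => Real.exp (-(t * N ω + R ω)))
    (F' := fun t ω => -(N ω * Real.exp (-(t * N ω + R ω)))) (x₀ := t)
    (s := Metric.ball t 1) (bound := fun _ => m * Real.exp m)
    (Metric.ball_mem_nhds t one_pos)
    (Filter.Eventually.of_forall fun x => by fun_prop) hint (by fun_prop)
    (by
      filter_upwards [hNm] with ω hω x hx
      rw [norm_neg, norm_mul, Real.norm_of_nonneg (hN0 ω), Real.norm_of_nonneg (Real.exp_pos _).le]
      gcongr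
      have hx' : -1 ≤ x := by
        rw [Metric.mem_ball, Real.dist_eq] at hx
        have := (abs_lt.1 hx).1; linarith
      have := hR0 ω
      nlinarith [hN0 ω])
    (integrable_const _)
    (Filter.Eventually.of_forall fun ω x _ => by
      have h1 : HasDerivAt (fun x : ℝ => -(x * N ω + R ω)) (-(1 * N ω)) x :=
        (((hasDerivAt_id x).mul_const (N ω)).add_const (R ω)).neg
      exact h1.exp.congr_deriv (by ring))
  have hφ : 0 < 1 - q + q * Real.exp (-t) := by
    have := Real.exp_pos (-t); nlinarith
  set G := Real.exp (m * Real.log (1 - q + q * Real.exp (-t)) + K) with hG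
  have hder2 : HasDerivAt (fun t : ℝ => Real.exp (m * Real.log (1 - q + q * Real.exp (-t)) + K))
      (G * (m * ((q * (Real.exp (-t) * (-1))) / (1 - q + q * Real.exp (-t))))) t := by
    have h1 : HasDerivAt (fun t : ℝ => 1 - q + q * Real.exp (-t)) (q * (Real.exp (-t) * (-1))) t :=
      (((hasDerivAt_neg t).exp).const_mul q).const_add (1 - q)
    exact (((h1.log hφ.ne').const_mul m).add_const K).exp
  have heq := UniqueDiffWithinAt.eq_deriv (Set.Ici 0) (uniqueDiffOn_Ici 0 t ht)
    hder.2.hasDerivWithinAt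
    ((hder2.hasDerivWithinAt (s := Set.Ici 0)).congr (fun x hx => hE x hx) (hE t ht))
  rw [integral_neg] at heq
  have hNint : Integrable (fun ω => N ω * Real.exp (-(t * N ω + R ω))) T := by
    simpa using hder.1.neg
  have h3 : ∫ ω, (q / (1 - q) * (m - N ω)) * Real.exp (-(t * (N ω + 1) + R ω)) ∂T
     = q / (1 - q) * Real.exp (-t) * (m * ∫ ω, Real.exp (-(t * N ω + R ω)) ∂T
       - ∫ ω, N ω * Real.exp (-(t * N ω + R ω)) ∂T) := by
    rw [← integral_const_mul, ← integral_sub (hint.const_mul m) hNint, ← integral_const_mul]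
    congr 1; ext ω
    rw [show -(t * (N ω + 1) + R ω) = -t + -(t * N ω + R ω) by ring, Real.exp_add]
    ring
  rw [h3, hE t ht, ← hG]
  have h4 : ∫ ω, N ω * Real.exp (-(t * N ω + R ω)) ∂T
    = G * (m * ((q * Real.exp (-t)) / (1 - q + q * Real.exp (-t)))) := by
    rw [neg_eq_iff_eq_neg.1 heq]
    ring
  rw [h4]
  have : 1 - q ≠ 0 := by linarith
  field_simp
  ring

theorem aux_unique {ι : Type*} [Countable ι] (P P' : Measure (ι → ℝ≥0)) [IsFiniteMeasure P]
    [IsFiniteMeasure P']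
    (h : ∀ a : ι →₀ ℝ≥0, ∫ ω, Real.exp (-(a.sum fun i r => (r : ℝ) * (ω i : ℝ))) ∂P
      = ∫ ω, Real.exp (-(a.sum fun i r => (r : ℝ) * (ω i : ℝ))) ∂P') : P = P' := by
  let S : Submonoid ((ι → ℝ≥0) →ᵇ ℝ) :=
    { carrier := {g | ∃ a : ι →₀ ℝ≥0, ∀ ω, g ω = Real.exp (-(a.sum fun i r => (r : ℝ) * (ω i : ℝ)))}
      mul_mem' := by
        rintro g g' ⟨a, ha⟩ ⟨b, hb⟩
        refine ⟨a + b, fun ω => ?_⟩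
        rw [Finsupp.sum_add_index' (by simp) (by intros; push_cast; ring),
          neg_add, Real.exp_add, BoundedContinuousFunction.coe_mul, Pi.mul_apply, ha, hb]
      one_mem' := ⟨0, by simp⟩ }
  let A : StarSubalgebra ℝ ((ι → ℝ≥0) →ᵇ ℝ) :=
    { Algebra.adjoin ℝ (S : Set ((ι → ℝ≥0) →ᵇ ℝ)) with
      star_mem' := by
        intro a ha
        have : star a = a := by ext; simp
        rw [this]; exact ha }
  refine ext_of_forall_mem_subalgebra_integral_eq_of_polish (𝕜 := ℝ) (A := A) ?_ ?_
  · intro ω ω' hne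
    obtain ⟨i, hi⟩ := Function.ne_iff.1 hne
    let g : (ι → ℝ≥0) →ᵇ ℝ := BoundedContinuousFunction.ofNormedAddCommGroup
      (fun ω => Real.exp (-(ω i : ℝ))) (by fun_prop) 1 (fun ω => by
        rw [Real.norm_of_nonneg (Real.exp_pos _).le, Real.exp_le_one_iff]
        simp)
    have hg : g ∈ A := Algebra.subset_adjoin (by
      refine ⟨Finsupp.single i 1, fun ω => ?_⟩
      rw [Finsupp.sum_single_index (by simp)]
      simp [g])
    refine ⟨g, ⟨BoundedContinuousFunction.toContinuousMapStarₐ ℝ g, ⟨g, hg, rfl⟩, rfl⟩, ?_⟩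
    simpa [g] using hi
  · intro g hg
    have hg' : g ∈ Algebra.adjoin ℝ (S : Set ((ι → ℝ≥0) →ᵇ ℝ)) := hg
    rw [← Subalgebra.mem_toSubmodule, Algebra.adjoin_eq_span, Submonoid.closure_eq] at hg'
    clear hg
    induction hg' using Submodule.span_induction with
    | mem x hx =>
      obtain ⟨a, ha⟩ := hx
      simp only [ha, h a]
    | zero => simp
    | add x y _ _ hx hy =>
      simp only [BoundedContinuousFunction.coe_add, Pi.add_apply]
      rw [integral_add (x.integrable P) (y.integrable P),
        integral_add (x.integrable P') (y.integrable P'), hx, hy]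
    | smul c x _ hx =>
      simp only [BoundedContinuousFunction.coe_smul, integral_const_mul, smul_eq_mul, hx]

theorem aux_laplace {X : Type*} [MeasurableSpace X] [MetricSpace X]
    [BorelSpace X] (q : ℝ) (hq : q ∈ Set.Ioo (0 : ℝ) 1)
    (μ : Measure X) (hμ : IsPointMeasure μ)
    (T : Measure (Measure X)) (hT : IsThinning q μ T) (s : Finset X) (a : X → ℝ)
    (ha : ∀ x, 0 ≤ a x) :
    ∫ κ, Real.exp (-(∑ y ∈ s, a y * (κ {y}).toReal)) ∂T
      = Real.exp (∑ y ∈ s, (μ {y}).toReal * Real.log (1 - q + q * Real.exp (-a y))) := by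
  classical
  obtain ⟨hprob, hae, hL⟩ := hT
  have hlf := hμ.2
  obtain ⟨hq0, hq1⟩ := hq
  have hfin : ∀ y, μ {y} < ∞ := fun y => isCompact_singleton.measure_lt_top
  let f : X → ℝ := fun x => if x ∈ s then a x else 0
  have key : ∀ (ν : Measure X), (∀ y, ν {y} < ∞) → ∀ G : ℝ → ℝ, G 0 = 0 → (∀ x, 0 ≤ x → 0 ≤ G x) →
      expNeg (∫⁻ x, ENNReal.ofReal (G (f x)) ∂ν)
        = ENNReal.ofReal (Real.exp (-(∑ y ∈ s, G (a y) * (ν {y}).toReal))) := by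
    intro ν hν G hG0 hG
    rw [← setLIntegral_eq_of_support_subset (s := (s : Set X)), lintegral_finset]
    · have h1 : ∑ x ∈ s, ENNReal.ofReal (G (f x)) * ν {x}
          = ENNReal.ofReal (∑ y ∈ s, G (a y) * (ν {y}).toReal) := by
        rw [ENNReal.ofReal_sum_of_nonneg
          (fun i _ => mul_nonneg (hG _ (ha i)) ENNReal.toReal_nonneg)]
        refine Finset.sum_congr rfl fun y hy => ?_
        rw [ENNReal.ofReal_mul (hG _ (ha y)), ENNReal.ofReal_toReal (hν y).ne]
        simp [f, hy]
      rw [h1, expNeg, if_neg ENNReal.ofReal_ne_top, ENNReal.toReal_ofReal]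
      exact Finset.sum_nonneg (fun i _ => mul_nonneg (hG _ (ha i)) ENNReal.toReal_nonneg)
    · intro x hx
      by_contra hxs
      apply hx
      have : x ∉ s := hxs
      simp [f, this, hG0]
  have hU : MemU f := by
    refine ⟨?_, ?_, ?_, ?_⟩
    · refine (measurable_const (a := (0 : ℝ))).measurable_of_countable_ne
        (s.countable_toSet.mono fun x hx => ?_)
      by_contra hxs
      apply hx
      have : x ∉ s := hxs
      simp [f, this]
    · intro x; dsimp only [f]; split_ifs; exacts [ha x, le_rfl]
    · refine ⟨∑ y ∈ s, a y, fun x => ?_⟩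
      dsimp only [f]; split_ifs with hx
      · exact Finset.single_le_sum (fun i _ => ha i) hx
      · exact Finset.sum_nonneg fun i _ => ha i
    · refine s.finite_toSet.isBounded.subset fun x hx => ?_
      by_contra hxs
      apply hx
      have : x ∉ s := hxs
      simp [f, this]
  have h := hL f hU
  rw [key μ hfin (fun u => -Real.log (1 - q + q * Real.exp (-u))) (by simp) (by
    intro x hx
    have h1 : Real.exp (-x) ≤ 1 := by simpa using hx
    have h2 := Real.exp_pos (-x)
    have := Real.log_nonpos (x := 1 - q + q * Real.exp (-x)) (by nlinarith) (by nlinarith)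
    linarith)] at h
  have h2 : laplaceT T f
      = ∫⁻ κ, ENNReal.ofReal (Real.exp (-(∑ y ∈ s, a y * (κ {y}).toReal))) ∂T := by
    refine lintegral_congr_ae ?_
    filter_upwards [hae] with κ hκ
    exact key κ (fun y => (hκ.2 {y}).trans_lt (hfin y)) id rfl (fun x hx => hx)
  rw [h2] at h
  rw [integral_eq_lintegral_of_nonneg_ae (Filter.Eventually.of_forall fun _ => (Real.exp_pos _).le), h,
    ENNReal.toReal_ofReal (Real.exp_pos _).le]
  · congr 1
    rw [← Finset.sum_neg_distrib]
    exact Finset.sum_congr rfl fun y _ => by ring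
  · refine Measurable.aestronglyMeasurable ?_
    refine Real.measurable_exp.comp (Measurable.neg (Finset.measurable_sum _ fun y _ => ?_))
    exact ((Measure.measurable_coe (measurableSet_singleton y)).ennreal_toReal).const_mul _

theorem aux_lintegral {X : Type*} [MeasurableSpace X] [MeasurableSingletonClass X]
    {A : Set X} (hA : A.Countable) (κ : Measure X) (hκ : κ Aᶜ = 0) (g : X → ℝ≥0∞) :
    ∫⁻ x, g x ∂κ = ∑' y : A, g y * κ {(y : X)} := by
  rw [← lintegral_countable g hA, Measure.restrict_eq_self_of_ae_mem]
  exact hκ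

theorem aux_sub {X : Type*} [MeasurableSpace X] [MeasurableSingletonClass X]
    (μ κ : Measure X) (h : κ ≤ μ) (y : X) (hy : μ {y} < ∞) :
    (μ - κ) {y} = μ {y} - κ {y} := by
  have h1 : (μ - κ) {y} = ((μ - κ).restrict {y}) {y} := by simp
  have : IsFiniteMeasure (κ.restrict {y}) := ⟨by simpa using (h {y}).trans_lt hy⟩
  rw [h1, Measure.restrict_sub_eq_restrict_sub_restrict (measurableSet_singleton y),
    Measure.sub_apply (measurableSet_singleton y) (Measure.restrict_mono le_rfl h)]
  simp

/-- masses at the points of `A` -/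
def auxPhi {X : Type*} [MeasurableSpace X] (A : Set X) (κ : Measure X) : A → ℝ≥0 :=
  fun y => (κ {(y : X)}).toNNReal

/-- reconstruct the measure from the masses -/
def auxPsi {X : Type*} [MeasurableSpace X] (A : Set X) (ω : A → ℝ≥0) : Measure X :=
  Measure.sum fun y : A => (ω y : ℝ≥0∞) • Measure.dirac (y : X)

theorem measurable_auxPhi {X : Type*} [MeasurableSpace X] [MeasurableSingletonClass X]
    (A : Set X) : Measurable (auxPhi A) :=
  measurable_pi_lambda _ fun y =>
    (Measure.measurable_coe (measurableSet_singleton (y : X))).ennreal_toNNReal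

theorem measurable_auxPsi {X : Type*} [MeasurableSpace X] {A : Set X} (hA : A.Countable) :
    Measurable (auxPsi A) := by
  have := hA.to_subtype
  refine Measure.measurable_of_measurable_coe _ fun s hs => ?_
  simp only [auxPsi, Measure.sum_apply _ hs, Measure.smul_apply, smul_eq_mul]
  refine Measurable.tsum fun y => ?_
  exact ((measurable_pi_apply y).coe_nnreal_ennreal).mul_const _

theorem auxPsi_auxPhi {X : Type*} [MeasurableSpace X] [MeasurableSingletonClass X]
    {A : Set X} (hA : A.Countable) (κ : Measure X) (hκ : κ Aᶜ = 0) (hfin : ∀ y, κ {y} < ∞) :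
    auxPsi A (auxPhi A κ) = κ := by
  ext s hs
  rw [← lintegral_indicator_one hs, ← lintegral_indicator_one hs, aux_lintegral hA κ hκ,
    auxPsi, lintegral_sum_measure]
  refine tsum_congr fun y => ?_
  rw [lintegral_smul_measure, lintegral_dirac, auxPhi, ENNReal.coe_toNNReal (hfin _).ne,
    smul_eq_mul, mul_comm]

theorem aux_key {X : Type*} [MeasurableSpace X] [MetricSpace X]
    [BorelSpace X] (q : ℝ) (hq : q ∈ Set.Ioo (0 : ℝ) 1)
    (μ : Measure X) (hμ : IsPointMeasure μ)
    (T : Measure (Measure X)) (hT : IsThinning q μ T) {A : Set X} (hA : A.Countable)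
    (hμA : μ Aᶜ = 0) (x : A) (g : Measure X → ℝ≥0∞) (hg : Measurable g) :
    ∫⁻ κ, g κ * κ {(x : X)} ∂T
      = ∫⁻ κ, ENNReal.ofReal (q / (1 - q)) * g (κ + Measure.dirac (x : X))
          * (μ {(x : X)} - κ {(x : X)}) ∂T := by
  classical
  have := hA.to_subtype
  have hprob := hT.1
  have hlf := hμ.2
  have hfin : ∀ y, μ {y} < ∞ := fun y => isCompact_singleton.measure_lt_top
  have hle : ∀ᵐ κ ∂T, κ ≤ μ := hT.2.1.mono fun κ h => h.2
  have hc0 : 0 ≤ q / (1 - q) := div_nonneg hq.1.le (by linarith [hq.2])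
  have hcoe : ∀ y : X, Measurable fun κ : Measure X => κ {y} := fun y =>
    Measure.measurable_coe (measurableSet_singleton y)
  let d1 : Measure X → ℝ≥0∞ := fun κ => κ {(x : X)}
  let d2 : Measure X → ℝ≥0∞ := fun κ => ENNReal.ofReal (q / (1 - q)) * (μ {(x : X)} - κ {(x : X)})
  have hd1 : Measurable d1 := hcoe x
  have hd2 : Measurable d2 := ((hcoe x).const_sub _).const_mul _
  have hd1le : ∀ᵐ κ ∂T, d1 κ ≤ μ {(x : X)} := hle.mono fun κ h => h _
  have hd2le : ∀ κ, d2 κ ≤ ENNReal.ofReal (q / (1 - q)) * μ {(x : X)} := fun κ => by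
    dsimp only [d2]; gcongr; exact tsub_le_self
  have hctop : ENNReal.ofReal (q / (1 - q)) * μ {(x : X)} < ∞ :=
    ENNReal.mul_lt_top ENNReal.ofReal_lt_top (hfin x)
  let shiftM : Measure X → Measure X := fun κ => κ + Measure.dirac (x : X)
  have hadd : Measurable shiftM := measurable_id.add_const _
  have hPhi := measurable_auxPhi A
  have hPsi := measurable_auxPsi hA
  have hPa : Measurable fun κ : Measure X => auxPhi A (shiftM κ) := hPhi.comp hadd
  have hgP : Measurable fun ω : A → ℝ≥0 => g (auxPsi A ω) := hg.comp hPsi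
  have hF1 : IsFiniteMeasure (T.withDensity d1) := isFiniteMeasure_withDensity (by
    refine ((lintegral_mono_ae hd1le).trans_lt ?_).ne
    simpa using hfin x)
  have hF2 : IsFiniteMeasure (T.withDensity d2) := isFiniteMeasure_withDensity (by
    refine ((lintegral_mono hd2le).trans_lt ?_).ne
    simpa using hctop)
  have hmain : (T.withDensity d1).map (auxPhi A)
      = (T.withDensity d2).map (fun κ => auxPhi A (shiftM κ)) := by
    have : IsFiniteMeasure ((T.withDensity d1).map (auxPhi A)) := inferInstance
    have : IsFiniteMeasure ((T.withDensity d2).map (fun κ => auxPhi A (shiftM κ))) := inferInstance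
    refine aux_unique _ _ fun a => ?_
    have hcont : Continuous fun ω : A → ℝ≥0 =>
        Real.exp (-(a.sum fun i r => (r : ℝ) * (ω i : ℝ))) := by
      unfold Finsupp.sum; fun_prop
    rw [integral_map hPhi.aemeasurable hcont.aestronglyMeasurable,
      integral_map hPa.aemeasurable hcont.aestronglyMeasurable,
      integral_withDensity_eq_integral_toReal_smul hd1 (hd1le.mono fun κ h => h.trans_lt (hfin x)),
      integral_withDensity_eq_integral_toReal_smul hd2
        (Filter.Eventually.of_forall fun κ => (hd2le κ).trans_lt hctop)]
    let s : Finset X := (a.support.erase x).map (Function.Embedding.subtype _)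
    let b : X → ℝ := fun z => if h : z ∈ A then (a ⟨z, h⟩ : ℝ) else 0
    have hb0 : ∀ z, 0 ≤ b z := fun z => by dsimp only [b]; split_ifs <;> simp
    have hxs : (x : X) ∉ s := by simp [s]
    let R : Measure X → ℝ := fun κ => ∑ y ∈ s, b y * (κ {y}).toReal
    have hR : Measurable R := Finset.measurable_sum _ fun y _ => (hcoe y).ennreal_toReal.const_mul _
    have hsum : ∀ κ : Measure X, (a.sum fun i r => (r : ℝ) * (auxPhi A κ i : ℝ))
        = (a x : ℝ) * (κ {(x : X)}).toReal + R κ := by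
      intro κ
      have h1 : (a.sum fun i r => (r : ℝ) * (auxPhi A κ i : ℝ))
          = ∑ i ∈ insert x (a.support.erase x), (a i : ℝ) * (auxPhi A κ i : ℝ) := by
        rw [Finsupp.sum]
        refine Finset.sum_subset (fun i hi => ?_) (fun i _ hi => ?_)
        · by_cases h : i = x <;> simp_all
        · have : a i = 0 := by simpa using hi
          simp [this]
      rw [h1, Finset.sum_insert (by simp)]
      congr 1
      dsimp only [R, s]
      rw [Finset.sum_map]
      refine Finset.sum_congr rfl fun i _ => ?_
      simp [b, auxPhi, ENNReal.toReal]
    have hcore := aux_core T q hq (fun κ => (κ {(x : X)}).toReal) R (hcoe x).ennreal_toReal hR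
      (μ {(x : X)}).toReal (∑ y ∈ s, (μ {y}).toReal * Real.log (1 - q + q * Real.exp (-b y)))
      (fun _ => ENNReal.toReal_nonneg)
      (hle.mono fun κ h => ENNReal.toReal_mono (hfin x).ne (h _))
      (fun κ => Finset.sum_nonneg fun y _ => mul_nonneg (hb0 y) ENNReal.toReal_nonneg)
      (fun t ht => by
        have h := aux_laplace q hq μ hμ T hT (insert (x : X) s) (Function.update b x t) (fun z => by
          by_cases hz : z = x
          · subst hz; simpa using ht
          · simpa [hz] using hb0 z)
        have hupd : ∀ y ∈ s, Function.update b x t y = b y := fun y hy =>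
          Function.update_of_ne (fun (h : y = x) => hxs (h ▸ hy)) _ _
        rw [Finset.sum_insert hxs, Function.update_self,
          Finset.sum_congr rfl (fun y hy => by rw [hupd y hy])] at h
        rw [← h]
        congr 1; ext κ
        rw [Finset.sum_insert hxs, Function.update_self,
          Finset.sum_congr rfl (fun y hy => by rw [hupd y hy])])
      (a x) (NNReal.coe_nonneg _)
    simp only [hsum, smul_eq_mul]
    refine hcore.trans (integral_congr_ae ?_)
    filter_upwards [hle] with κ hκ
    have hκx : κ {(x : X)} < ∞ := (hκ _).trans_lt (hfin x)
    have e1 : (shiftM κ {(x : X)}).toReal = (κ {(x : X)}).toReal + 1 := by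
      simp [shiftM, ENNReal.toReal_add hκx.ne]
    have e2 : R (shiftM κ) = R κ := by
      refine Finset.sum_congr rfl fun y hy => ?_
      have : (x : X) ≠ y := fun h => hxs (h ▸ hy)
      simp [shiftM, this]
    have e3 : (d2 κ).toReal = q / (1 - q) * ((μ {(x : X)}).toReal - (κ {(x : X)}).toReal) := by
      dsimp only [d2]
      rw [ENNReal.toReal_mul, ENNReal.toReal_ofReal hc0,
        ENNReal.toReal_sub_of_le (hκ _) (hfin x).ne]
    rw [e1, e2, e3]
  have hA1 : ∀ κ ≤ μ, κ Aᶜ = 0 := fun κ h => le_antisymm ((h _).trans hμA.le) bot_le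
  calc ∫⁻ κ, g κ * κ {(x : X)} ∂T
      = ∫⁻ κ, d1 κ * g (auxPsi A (auxPhi A κ)) ∂T := by
        refine lintegral_congr_ae ?_
        filter_upwards [hle] with κ hκ
        rw [auxPsi_auxPhi hA κ (hA1 κ hκ) (fun y => (hκ _).trans_lt (hfin y)), mul_comm]
    _ = ∫⁻ ω, g (auxPsi A ω) ∂((T.withDensity d1).map (auxPhi A)) := by
        rw [lintegral_map hgP hPhi]
        exact (lintegral_withDensity_eq_lintegral_mul _ hd1 (hgP.comp hPhi)).symm
    _ = ∫⁻ κ, d2 κ * g (auxPsi A (auxPhi A (shiftM κ))) ∂T := by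
        rw [hmain, lintegral_map hgP hPa]
        exact lintegral_withDensity_eq_lintegral_mul _ hd2 (hgP.comp hPa)
    _ = _ := by
        refine lintegral_congr_ae ?_
        filter_upwards [hle] with κ hκ
        rw [auxPsi_auxPhi hA (shiftM κ)]
        · dsimp only [d2, shiftM]; ring
        · have : (x : X) ∉ Aᶜ := by simp
          simp [shiftM, hA1 κ hκ, Measure.dirac_apply' _ hA.measurableSet.compl, this]
        · intro y
          simp only [shiftM, Measure.add_apply]
          exact ENNReal.add_lt_top.2 ⟨(hκ _).trans_lt (hfin y), measure_lt_top _ _⟩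

/-- The independent `q`-thinning `T^μ_q` of a Radon point measure `μ` admits the
Papangelou kernel `π(κ,dx) = (q/(1-q)) (μ-κ)(dx)`: its Campbell measure satisfies
`∫∫ h(x,κ) κ(dx) T^μ_q(dκ) = ∫∫ h(x,κ+δ_x) (q/(1-q)) (μ-κ)(dx) T^μ_q(dκ)`. -/
theorem statement0 {X : Type*} [MeasurableSpace X] [MetricSpace X] [PolishSpace X]
    [BorelSpace X] (q : ℝ) (hq : q ∈ Set.Ioo (0 : ℝ) 1)
    (μ : Measure X) (hμ : IsPointMeasure μ)
    (T : Measure (Measure X)) (hT : IsThinning q μ T) :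
    ∀ h : X → Measure X → ℝ≥0∞, Measurable (Function.uncurry h) →
      ∫⁻ κ, ∫⁻ x, h x κ ∂κ ∂T
        = ∫⁻ κ, ∫⁻ x, ENNReal.ofReal (q / (1 - q)) * h x (κ + Measure.dirac x)
            ∂(μ - κ) ∂T := by
  intro h hh
  have hlf := hμ.2
  obtain ⟨D, hD⟩ := hμ.1
  have hfin : ∀ y, μ {y} < ∞ := fun y => isCompact_singleton.measure_lt_top
  let A : Set X := {x | ∃ n, D n = some x}
  have hA : A.Countable := by
    have : A ⊆ ⋃ n, {x | D n = some x} := fun x ⟨n, hn⟩ => Set.mem_iUnion.2 ⟨n, hn⟩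
    refine (Set.countable_iUnion fun n => ?_).mono this
    refine Set.Subsingleton.countable fun y hy z hz => ?_
    have h1 : D n = some y := hy
    have h2 : D n = some z := hz
    exact Option.some_injective _ (h1.symm.trans h2)
  have hμA : μ Aᶜ = 0 := by
    rw [hD, Measure.sum_apply _ hA.measurableSet.compl, ENNReal.tsum_eq_zero]
    intro n
    cases hn : D n with
    | none => simp
    | some x =>
      have hx : x ∉ Aᶜ := fun hx => hx ⟨n, hn⟩
      simp [Measure.dirac_apply' _ hA.measurableSet.compl, hx]
  have hle : ∀ᵐ κ ∂T, κ ≤ μ := hT.2.1.mono fun κ h => h.2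
  have hcount := hA.to_subtype
  have hcoe : ∀ y : X, Measurable fun κ : Measure X => κ {y} := fun y =>
    Measure.measurable_coe (measurableSet_singleton y)
  have hmh : ∀ y, Measurable (h y) := fun y => hh.of_uncurry_left
  have hL : ∫⁻ κ, ∫⁻ x, h x κ ∂κ ∂T = ∫⁻ κ, ∑' y : A, h y κ * κ {(y : X)} ∂T := by
    refine lintegral_congr_ae ?_
    filter_upwards [hle] with κ hκ
    exact aux_lintegral hA κ (le_antisymm ((hκ _).trans hμA.le) bot_le) _
  have hR : ∫⁻ κ, ∫⁻ x, ENNReal.ofReal (q / (1 - q)) * h x (κ + Measure.dirac x) ∂(μ - κ) ∂T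
      = ∫⁻ κ, ∑' y : A, ENNReal.ofReal (q / (1 - q)) * h y (κ + Measure.dirac (y : X))
          * (μ {(y : X)} - κ {(y : X)}) ∂T := by
    refine lintegral_congr_ae ?_
    filter_upwards [hle] with κ hκ
    rw [aux_lintegral hA (μ - κ) (le_antisymm ((Measure.sub_le _).trans hμA.le) bot_le)]
    exact tsum_congr fun y => by rw [aux_sub μ κ hκ y (hfin y)]
  rw [hL, hR, lintegral_tsum, lintegral_tsum]
  · exact tsum_congr fun y => aux_key q hq μ hμ T hT hA hμA y (h y) (hmh y)
  · intro y
    exact (((((hmh y).comp (measurable_id.add_const (Measure.dirac (y : X))))).const_mul _).mul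
      ((hcoe y).const_sub _)).aemeasurable
  · intro y
    exact ((hmh y).mul (hcoe y)).aemeasurable
end
end

section
/- Let X be a Polish space, P a point process on X of first order and q ∈ (0,1), and suppose the splitting law factorizes: S_q(P) = Γ_q(P) ⊗ Γ_{1−q}(P). Then the Campbell measure of Γ_q(P) satisfies, for every non-negative measurable h on X × M··(X), C_{Γ_q(P)}(h) = ∫ Γ_q(P)(dκ) ∫ h(x, κ + δ_x) q ν_P(dx); i.e. Γ_q(P) has the constant Papangelou kernel q ν_P, and consequently Γ_q(P) = Π_{q ν_P}. -/
open MeasureTheory ENNReal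

noncomputable section

open MeasureTheory ENNReal PoissonSplitting

namespace PS8

open Filter Topology

theorem expNeg_eq (a : ℝ≥0∞) : expNeg a = EReal.exp (-(a : EReal)) := by
  unfold expNeg
  split_ifs with h
  · simp [h]
  · lift a to NNReal using h
    have : -(((a : ℝ≥0∞)) : EReal) = ((-(a : ℝ) : ℝ) : EReal) := by
      rw [EReal.coe_neg]; rfl
    rw [this, EReal.exp_coe]; simp

theorem expNeg_zero : expNeg 0 = 1 := by simp [expNeg]

theorem expNeg_add (a b : ℝ≥0∞) : expNeg (a + b) = expNeg a * expNeg b := by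
  rw [expNeg_eq, expNeg_eq, expNeg_eq, ← EReal.exp_add, EReal.coe_ennreal_add,
    EReal.neg_add (by simp) (by simp), sub_eq_add_neg]

theorem expNeg_cont : Continuous expNeg := by
  have : expNeg = fun a : ℝ≥0∞ => EReal.exp (-(a : EReal)) := funext expNeg_eq
  rw [this]
  exact ENNReal.continuous_exp.comp (continuous_neg.comp continuous_coe_ennreal_ereal)

theorem expNeg_meas : Measurable expNeg := expNeg_cont.measurable

theorem expNeg_anti : Antitone expNeg := by
  intro a b h
  rw [expNeg_eq, expNeg_eq]
  exact EReal.exp_monotone (EReal.neg_le_neg_iff.2 (by exact_mod_cast h))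

theorem expNeg_le_one (a : ℝ≥0∞) : expNeg a ≤ 1 := by
  rw [← expNeg_zero]; exact expNeg_anti (zero_le)

theorem expNeg_ne_top (a : ℝ≥0∞) : expNeg a ≠ ∞ := ne_top_of_le_ne_top one_ne_top (expNeg_le_one a)

theorem expNeg_of_ne_top {a : ℝ≥0∞} (h : a ≠ ∞) :
    expNeg a = ENNReal.ofReal (Real.exp (-a.toReal)) := by simp [expNeg, h]

theorem one_sub_expNeg_le (a : ℝ≥0∞) : 1 - expNeg a ≤ a := by
  by_cases h : a = ∞
  · simp [h]
  rw [expNeg_of_ne_top h, tsub_le_iff_right]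
  nth_rw 1 [← ENNReal.ofReal_toReal h]
  rw [← ENNReal.ofReal_add (by positivity) (by positivity), ← ENNReal.ofReal_one]
  apply ENNReal.ofReal_le_ofReal
  have := Real.add_one_le_exp (-a.toReal)
  linarith

/-- If `n c_n → c < ∞` then `n (1 - e^{-c_n}) → c`. -/
theorem tendsto_mul_one_sub {c : ℕ → ℝ≥0∞} {l : ℝ≥0∞} (hl : l ≠ ∞)
    (h : Tendsto (fun n : ℕ => (n : ℝ≥0∞) * c n) atTop (𝓝 l)) :
    Tendsto (fun n : ℕ => (n : ℝ≥0∞) * (1 - expNeg (c n))) atTop (𝓝 l) := by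
  have hfin : ∀ᶠ n : ℕ in atTop, c n ≠ ∞ := by
    filter_upwards [h.eventually_lt_const (lt_top_iff_ne_top.2 hl), eventually_gt_atTop 0]
      with n hn hn0 hc
    rw [hc, ENNReal.mul_top (by simpa using hn0.ne')] at hn
    exact lt_irrefl _ hn
  set b : ℕ → ℝ := fun n => (n * c n).toReal with hb
  have hbt : Tendsto b atTop (𝓝 l.toReal) := (ENNReal.tendsto_toReal hl).comp h
  have key : Tendsto (fun n : ℕ => (n : ℝ) * (1 - Real.exp (-(c n).toReal))) atTop
      (𝓝 l.toReal) := by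
    have h1 : Tendsto (fun n : ℕ => b n - b n ^ 2 / n) atTop (𝓝 (l.toReal)) := by
      have : Tendsto (fun n : ℕ => b n ^ 2 / n) atTop (𝓝 0) :=
        (hbt.pow 2).div_atTop tendsto_natCast_atTop_atTop
      simpa using hbt.sub this
    have hc0 : Tendsto (fun n : ℕ => (c n).toReal) atTop (𝓝 0) := by
      have : Tendsto (fun n : ℕ => b n / n) atTop (𝓝 0) :=
        hbt.div_atTop tendsto_natCast_atTop_atTop
      refine this.congr' ?_
      filter_upwards [eventually_gt_atTop 0] with n hn
      have : (n : ℝ) ≠ 0 := by positivity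
      simp only [hb, ENNReal.toReal_mul, ENNReal.toReal_natCast]
      field_simp
    refine tendsto_of_tendsto_of_tendsto_of_le_of_le' h1 hbt ?_ ?_
    · filter_upwards [eventually_gt_atTop 0, hc0.eventually_le_const (zero_lt_one)] with n hn hc1
      have hn' : (0 : ℝ) < n := by positivity
      have hx : 0 ≤ (c n).toReal := by positivity
      have h2 := Real.abs_exp_sub_one_sub_id_le (x := -(c n).toReal)
        (by rw [abs_neg, abs_of_nonneg hx]; exact hc1)
      have h3 := (abs_le.1 h2).2
      simp only [hb, ENNReal.toReal_mul, ENNReal.toReal_natCast]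
      have : (n * (c n).toReal) ^ 2 / (n : ℝ) = n * (c n).toReal ^ 2 := by field_simp
      rw [this]
      nlinarith
    · filter_upwards with n
      simp only [hb, ENNReal.toReal_mul, ENNReal.toReal_natCast]
      have := Real.add_one_le_exp (-(c n).toReal)
      have hn' : (0 : ℝ) ≤ n := by positivity
      nlinarith
  have := ENNReal.tendsto_ofReal key
  rw [ENNReal.ofReal_toReal hl] at this
  refine this.congr' ?_
  filter_upwards [hfin] with n hn
  rw [expNeg_of_ne_top hn, ENNReal.ofReal_mul (by positivity), ENNReal.ofReal_natCast,
    ENNReal.ofReal_sub _ (by positivity), ENNReal.ofReal_one]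

/-- If `d_n ≤ 1` and `n d_n → d < ∞` then `(1 - d_n)^n → e^{-d}`. -/
theorem tendsto_one_sub_pow {d : ℕ → ℝ≥0∞} {l : ℝ≥0∞} (hl : l ≠ ∞) (hd : ∀ n, d n ≤ 1)
    (h : Tendsto (fun n : ℕ => (n : ℝ≥0∞) * d n) atTop (𝓝 l)) :
    Tendsto (fun n : ℕ => (1 - d n) ^ n) atTop (𝓝 (expNeg l)) := by
  have hbt : Tendsto (fun n : ℕ => (n : ℝ) * (-(d n).toReal)) atTop (𝓝 (-l.toReal)) := by
    have := ((ENNReal.tendsto_toReal hl).comp h).neg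
    refine this.congr fun n => ?_
    simp
  have := ENNReal.tendsto_ofReal (Real.tendsto_one_add_pow_exp_of_tendsto hbt)
  rw [← expNeg_of_ne_top hl] at this
  refine this.congr fun n => ?_
  have hd1 : (d n).toReal ≤ 1 := by
    simpa using ENNReal.toReal_mono one_ne_top (hd n)
  have hdt : d n ≠ ∞ := ne_top_of_le_ne_top one_ne_top (hd n)
  rw [ENNReal.ofReal_pow (by linarith), ← sub_eq_add_neg, ENNReal.ofReal_sub _ (by positivity),
    ENNReal.ofReal_one, ENNReal.ofReal_toReal hdt]

end PS8

namespace PS8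

open Filter Topology

section PointMeas
set_option linter.unusedSectionVars false

variable {X : Type*} [MeasurableSpace X] [MetricSpace X] [PolishSpace X] [BorelSpace X]

/-- The value is an extended natural number. -/
def IntVal : Set ℝ≥0∞ := Set.range (fun n : ℕ => (n : ℝ≥0∞)) ∪ {∞}

theorem measurableSet_IntVal : MeasurableSet IntVal :=
  ((Set.countable_range _).union (Set.countable_singleton _)).measurableSet

theorem tsum_intVal {ι : Type*} (a : ι → ℝ≥0∞) (ha : ∀ i, a i = 0 ∨ a i = 1) :
    (∑' i, a i) ∈ IntVal := by
  by_cases h : ∑' i, a i = ∞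
  · right; exact h
  left
  have hf : {i | 1 ≤ a i}.Finite := ENNReal.finite_const_le_of_tsum_ne_top h one_ne_zero
  have : ∑' i, a i = ∑ i ∈ hf.toFinset, a i := by
    refine tsum_eq_sum fun i hi => ?_
    rcases ha i with h | h
    · exact h
    · exact absurd (by simp [h]) hi
  rw [this]
  refine ⟨hf.toFinset.card, ?_⟩
  rw [Finset.card_eq_sum_ones]
  push_cast
  refine Finset.sum_congr rfl fun i hi => ?_
  rcases ha i with h | h
  · simp [h] at hi
  · exact h.symm

theorem intVal_of_point {ν : Measure X} (h : IsPointMeasure ν) {V : Set X}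
    (hV : MeasurableSet V) : ν V ∈ IntVal := by
  obtain ⟨⟨D, rfl⟩, -⟩ := h
  rw [Measure.sum_apply _ hV]
  refine tsum_intVal _ fun n => ?_
  rcases D n with _ | x
  · simp
  · simp only [Option.elim, Measure.dirac_apply' _ hV]
    by_cases hx : x ∈ V <;> simp [hx]

theorem exists_nhd {ν : Measure X} [IsLocallyFiniteMeasure ν]
    (h : ∀ V ∈ TopologicalSpace.countableBasis X, ν V ∈ IntVal) (x : X) :
    ∃ V ∈ TopologicalSpace.countableBasis X, x ∈ V ∧ ν (V \ {x}) = 0 ∧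
      ∃ n : ℕ, ν {x} = n := by
  have hB := TopologicalSpace.isBasis_countableBasis X
  have hex : ∃ n : ℕ, ∃ V ∈ TopologicalSpace.countableBasis X, x ∈ V ∧ ν V = n := by
    obtain ⟨U, hxU, hU, hfin⟩ := ν.exists_isOpen_measure_lt_top x
    obtain ⟨V, hV, hxV, hVU⟩ := hB.exists_subset_of_mem_open hxU hU
    have hlt : ν V ≠ ∞ := ((measure_mono hVU).trans_lt hfin).ne
    rcases h V hV with ⟨n, hn⟩ | hn
    · exact ⟨n, V, hV, hxV, hn.symm⟩
    · exact absurd hn hlt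
  classical
  obtain ⟨V, hV, hxV, hn⟩ := Nat.find_spec hex
  have hnull : ν (V \ {x}) = 0 := by
    have hsub : V \ {x} ⊆ ⋃ W ∈ {W ∈ TopologicalSpace.countableBasis X | x ∈ W ∧ W ⊆ V},
        V \ W := by
      rintro y ⟨hyV, hyx⟩
      have hxy : x ∈ V ∩ {y}ᶜ := ⟨hxV, fun h => hyx h.symm⟩
      obtain ⟨W, hW, hxW, hWV⟩ := hB.exists_subset_of_mem_open hxy
        ((hB.isOpen hV).inter isOpen_compl_singleton)
      simp only [Set.mem_iUnion]
      exact ⟨W, ⟨hW, hxW, fun z hz => (hWV hz).1⟩, hyV, fun hyW => (hWV hyW).2 rfl⟩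
    refine measure_mono_null hsub ((measure_biUnion_null_iff
      ((TopologicalSpace.countable_countableBasis X).mono fun W hW => hW.1)).2 ?_)
    rintro W ⟨hW, hxW, hWV⟩
    have hle : ν W ≤ ν V := measure_mono hWV
    have hWfin : ν W ≠ ∞ := ne_top_of_le_ne_top (by rw [hn]; simp) hle
    rw [measure_sdiff hWV (hB.isOpen hW).measurableSet.nullMeasurableSet hWfin]
    rcases h W hW with ⟨m, hm⟩ | hm
    · have : Nat.find hex ≤ m := Nat.find_min' hex ⟨W, hW, hxW, hm.symm⟩
      rw [tsub_eq_zero_iff_le, hn, ← hm]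
      exact Nat.cast_le.2 this
    · exact absurd hm hWfin
  refine ⟨V, hV, hxV, hnull, Nat.find hex, ?_⟩
  rw [← hn]
  refine le_antisymm (measure_mono (by simpa using hxV)) ?_
  calc ν V ≤ ν ({x} ∪ V \ {x}) := measure_mono (by intro y hy; by_cases h : y = x <;> simp [h, hy])
    _ ≤ ν {x} + ν (V \ {x}) := measure_union_le _ _
    _ = ν {x} := by rw [hnull, add_zero]

theorem point_of_intVal {ν : Measure X} [IsLocallyFiniteMeasure ν]
    (h : ∀ V ∈ TopologicalSpace.countableBasis X, ν V ∈ IntVal) : IsPointMeasure ν := by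
  refine ⟨?_, inferInstance⟩
  choose V hV hxV hnull n hn using exists_nhd h
  set A : Set X := {x | ν {x} ≠ 0} with hA
  have hAc : A.Countable := by
    have hinj : Set.InjOn V A := by
      intro x hx y hy hxy
      by_contra hne
      have hyx : ({y} : Set X) ⊆ V x \ {x} := by
        rintro z rfl
        exact ⟨hxy ▸ hxV z, fun h => hne h.symm⟩
      exact hy (measure_mono_null hyx (hnull x))
    refine Set.MapsTo.countable_of_injOn (t := TopologicalSpace.countableBasis X)
      (fun x _ => hV x) hinj (TopologicalSpace.countable_countableBasis X)
  have hAnull : ν Aᶜ = 0 := by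
    refine measure_null_of_locally_null _ fun x _ => ⟨V x \ A, ?_, ?_⟩
    · rw [mem_nhdsWithin]
      exact ⟨V x, (TopologicalSpace.isBasis_countableBasis X).isOpen (hV x), hxV x,
        fun y hy => ⟨hy.1, hy.2⟩⟩
    · by_cases hx : x ∈ A
      · refine measure_mono_null ?_ (hnull x)
        rintro y ⟨hy1, hy2⟩
        refine ⟨hy1, fun h => hy2 ?_⟩
        rw [Set.mem_singleton_iff.1 h]; exact hx
      · have : ν {x} = 0 := by simpa [hA] using hx
        refine measure_mono_null (t := {x} ∪ V x \ {x}) ?_ (measure_union_null this (hnull x))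
        intro y hy; by_cases h : y = x <;> simp [h, hy.1]
  have := hAc.to_subtype
  have hrep : ∀ s, MeasurableSet s → ν s = ∑' a : A, (n a : ℝ≥0∞) * s.indicator 1 (a : X) := by
    intro s hs
    have h1 : ν s = ν (s ∩ A) := by
      refine le_antisymm ?_ (measure_mono Set.inter_subset_left)
      calc ν s ≤ ν ((s ∩ A) ∪ Aᶜ) := measure_mono (by intro y hy; by_cases h : y ∈ A <;> simp [h, hy])
        _ ≤ ν (s ∩ A) + ν Aᶜ := measure_union_le _ _
        _ = _ := by rw [hAnull, add_zero]
    have h2 : s ∩ A = ⋃ a : A, (s ∩ {(a : X)}) := by ext y; simp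
    rw [h1, h2, measure_iUnion]
    · refine tsum_congr fun a => ?_
      by_cases ha : (a : X) ∈ s
      · rw [Set.inter_eq_right.2 (by simpa using ha)]; simp [ha, hn]
      · rw [Set.inter_singleton_eq_empty.2 ha]; simp [ha]
    · intro a b hab
      simp only [Function.onFun]
      refine Set.disjoint_left.2 ?_
      rintro y ⟨_, hy⟩ ⟨_, hy'⟩
      exact hab (Subtype.ext (by rw [← hy, ← hy']))
    · intro a; exact hs.inter (measurableSet_singleton _)
  have hcount : Countable (Σ a : A, Fin (n a)) := inferInstance
  have := Encodable.ofCountable (Σ a : A, Fin (n a))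
  refine ⟨fun k => (Encodable.decode₂ (Σ a : A, Fin (n a)) k).map fun p => (p.1 : X), ?_⟩
  ext s hs
  rw [Measure.sum_apply _ hs, hrep s hs]
  have hinj : Function.Injective (Encodable.encode : (Σ a : A, Fin (n a)) → ℕ) :=
    Encodable.encode_injective
  rw [← hinj.tsum_eq]
  · rw [ENNReal.tsum_sigma']
    refine tsum_congr fun a => ?_
    simp [Encodable.decode₂_encode, Measure.dirac_apply' _ hs]
  · intro k hk
    rw [Function.mem_support] at hk
    rcases hd : Encodable.decode₂ (Σ a : A, Fin (n a)) k with _ | p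
    · simp [hd] at hk
    · exact ⟨p, Encodable.mem_decode₂.1 hd⟩

end PointMeas

section Sub
variable {X : Type*} [MeasurableSpace X]

theorem add_sub_of_le {μ ν : Measure X} [SigmaFinite ν] (h : ν ≤ μ) : ν + (μ - ν) = μ := by
  refine Measure.ext_of_iUnion_eq_univ (iUnion_spanningSets ν) fun i => ?_
  have hm := measurableSet_spanningSets ν i
  have : IsFiniteMeasure (ν.restrict (spanningSets ν i)) :=
    ⟨by simpa using measure_spanningSets_lt_top ν i⟩
  rw [Measure.restrict_add, Measure.restrict_sub_eq_restrict_sub_restrict hm, add_comm]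
  exact Measure.sub_add_cancel_of_le (Measure.restrict_mono le_rfl h)

end Sub

end PS8

namespace PS8

open Filter Topology

section Unique

set_option linter.unusedSectionVars false

variable {X : Type*} [MeasurableSpace X] [MetricSpace X]

theorem expNeg_inj : Function.Injective expNeg := by
  intro a b h
  rw [expNeg_eq, expNeg_eq] at h
  have := EReal.exp_strictMono.injective h
  simpa using this

theorem expNeg_sum {ι : Type*} (t : Finset ι) (k : ι → ℕ) (a : ι → ℝ≥0∞) :
    expNeg (∑ s ∈ t, (k s : ℝ≥0∞) * a s) = ∏ s ∈ t, expNeg (a s) ^ k s := by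
  have hn : ∀ (m : ℕ) (b : ℝ≥0∞), expNeg (m * b) = expNeg b ^ m := by
    intro m b
    induction m with
    | zero => simp [expNeg_zero]
    | succ m ih => rw [Nat.cast_succ, add_mul, one_mul, expNeg_add, ih, pow_succ]
  classical
  induction t using Finset.induction_on with
  | empty => simp [expNeg_zero]
  | insert i t hi ih => rw [Finset.sum_insert hi, Finset.prod_insert hi, expNeg_add, ih, hn]

/-- Monomials in `e^{-x_s}`. -/
def mono {ι : Type*} [Fintype ι] (k : ι → ℕ) : BoundedContinuousFunction (ι → ℝ≥0∞) ℝ :=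
  BoundedContinuousFunction.mkOfCompact ⟨fun x => ∏ s, (expNeg (x s)).toReal ^ k s, by
    refine continuous_finsetProd _ fun s _ => Continuous.pow ?_ _
    rw [continuous_iff_continuousAt]
    intro x
    exact (ENNReal.tendsto_toReal (expNeg_ne_top _)).comp
      ((expNeg_cont.comp (continuous_apply s)).tendsto x)⟩

theorem mono_apply {ι : Type*} [Fintype ι] (k : ι → ℕ) (x : ι → ℝ≥0∞) :
    mono k x = ∏ s, (expNeg (x s)).toReal ^ k s := rfl

/-- The submonoid of monomials. -/
def monoSub (ι : Type*) [Fintype ι] : Submonoid (BoundedContinuousFunction (ι → ℝ≥0∞) ℝ) where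
  carrier := Set.range mono
  one_mem' := ⟨0, by ext x; simp [mono_apply]⟩
  mul_mem' := by
    rintro _ _ ⟨k, rfl⟩ ⟨l, rfl⟩
    refine ⟨k + l, ?_⟩
    ext x
    simp [mono_apply, pow_add, Finset.prod_mul_distrib]

/-- The algebra spanned by monomials. -/
def monoAlg (ι : Type*) [Fintype ι] :
    StarSubalgebra ℝ (BoundedContinuousFunction (ι → ℝ≥0∞) ℝ) :=
  { Algebra.adjoin ℝ (monoSub ι : Set (BoundedContinuousFunction (ι → ℝ≥0∞) ℝ)) with
    star_mem' := by
      intro a ha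
      have : star a = a := by ext x; simp
      rw [this]; exact ha }

theorem monoAlg_sep (ι : Type*) [Fintype ι] :
    ((monoAlg ι).map (BoundedContinuousFunction.toContinuousMapStarₐ ℝ)).SeparatesPoints := by
  classical
  intro x y hxy
  obtain ⟨s, hs⟩ := Function.ne_iff.1 hxy
  refine ⟨_, ⟨_, ⟨mono (Pi.single s 1), Algebra.subset_adjoin ⟨_, rfl⟩, rfl⟩, rfl⟩, ?_⟩
  have h : ∀ z : ι → ℝ≥0∞, mono (Pi.single s 1) z = (expNeg (z s)).toReal := by
    intro z
    rw [mono_apply, Finset.prod_eq_single s]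
    · simp
    · intro b _ hb; simp [hb]
    · simp
  change mono (Pi.single s 1) x ≠ mono (Pi.single s 1) y
  rw [h, h]
  intro heq
  exact hs (expNeg_inj ((ENNReal.toReal_eq_toReal_iff' (expNeg_ne_top _) (expNeg_ne_top _)).1 heq))

theorem pi_unique {ι : Type*} [Fintype ι] {A B : Measure (ι → ℝ≥0∞)} [IsFiniteMeasure A]
    [IsFiniteMeasure B]
    (h : ∀ k : ι → ℕ, ∫⁻ x, expNeg (∑ s, (k s : ℝ≥0∞) * x s) ∂A
      = ∫⁻ x, expNeg (∑ s, (k s : ℝ≥0∞) * x s) ∂B) : A = B := by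
  refine ext_of_forall_mem_subalgebra_integral_eq_of_polish (𝕜 := ℝ) (monoAlg_sep ι) ?_
  intro g hg
  have hg' : g ∈ Submodule.span ℝ (monoSub ι : Set (BoundedContinuousFunction (ι → ℝ≥0∞) ℝ)) := by
    have h1 : g ∈ Algebra.adjoin ℝ
      (monoSub ι : Set (BoundedContinuousFunction (ι → ℝ≥0∞) ℝ)) := hg
    rw [← Subalgebra.mem_toSubmodule, Algebra.adjoin_eq_span, Submonoid.closure_eq] at h1
    exact h1
  clear hg
  induction hg' using Submodule.span_induction with
  | mem g hg =>
    obtain ⟨k, rfl⟩ := hg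
    have key : ∀ C : Measure (ι → ℝ≥0∞), ∫ x, mono k x ∂C =
        (∫⁻ x, expNeg (∑ s, (k s : ℝ≥0∞) * x s) ∂C).toReal := by
      intro C
      rw [← integral_toReal]
      · refine integral_congr_ae (Eventually.of_forall fun x => ?_)
        simp only [mono_apply, expNeg_sum, ENNReal.toReal_prod, ENNReal.toReal_pow]
      · refine (expNeg_meas.comp ?_).aemeasurable
        exact Finset.measurable_sum _ fun s _ => (measurable_pi_apply s).const_mul _
      · exact Eventually.of_forall fun x => lt_top_iff_ne_top.2 (expNeg_ne_top _)
    rw [key, key, h]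
  | zero => simp
  | add f g hf hg ihf ihg =>
    simp only [BoundedContinuousFunction.coe_add, Pi.add_apply]
    rw [integral_add (f.integrable _) (g.integrable _), integral_add (f.integrable _) (g.integrable _),
      ihf, ihg]
  | smul c f hf ih =>
    simp only [BoundedContinuousFunction.coe_smul, smul_eq_mul]
    rw [integral_const_mul, integral_const_mul, ih]

theorem laplace_unique {A B : Measure (Measure X)} [IsFiniteMeasure A] [IsFiniteMeasure B]
    (h : ∀ f : X → ℝ, Measurable f → (∀ x, 0 ≤ f x) → laplaceT A f = laplaceT B f) : A = B := by
  let m : {s : Set X // MeasurableSet s} → MeasurableSpace (Measure X) := fun s =>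
    MeasurableSpace.comap (fun ν : Measure X => ν s.1) inferInstance
  have huniv : A Set.univ = B Set.univ := by
    have := h 0 measurable_const (fun _ => le_rfl)
    simpa [laplaceT, pairing, expNeg_zero] using this
  refine ext_of_generate_finite (piiUnionInter (fun s => {t | MeasurableSet[m s] t}) Set.univ)
    ?_ (isPiSystem_piiUnionInter _ (fun s => @MeasurableSpace.isPiSystem_measurableSet _ (m s)) _) ?_ huniv
  · rw [generateFrom_piiUnionInter_measurableSet m Set.univ]
    simp only [Set.mem_univ, iSup_pos, m]
    rw [iSup_subtype]
    rfl
  · rintro _ ⟨t, -, ft, hft, rfl⟩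
    choose! E hEm hE using hft
    let Φ : Measure X → (t → ℝ≥0∞) := fun ν s => ν s.1.1
    have hΦ : Measurable Φ := measurable_pi_lambda _ fun s => Measure.measurable_coe s.1.2
    have hset : (⋂ s ∈ t, ft s) = Φ ⁻¹' (Set.univ.pi fun s : t => E s.1) := by
      ext ν
      simp only [Set.mem_iInter, Set.mem_preimage, Set.mem_pi, Set.mem_univ, true_imp_iff, Φ]
      constructor
      · rintro hν ⟨s, hs⟩
        have := hν s hs
        rw [← hE s hs] at this
        exact this
      · intro hν s hs
        rw [← hE s hs]
        exact hν ⟨s, hs⟩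
    have hmeas : MeasurableSet (Set.univ.pi fun s : t => E s.1) :=
      MeasurableSet.univ_pi fun s => hEm s.1 s.2
    rw [hset, ← Measure.map_apply hΦ hmeas, ← Measure.map_apply hΦ hmeas]
    have : A.map Φ = B.map Φ := by
      have := Measure.isFiniteMeasure_map A Φ
      have := Measure.isFiniteMeasure_map B Φ
      refine pi_unique fun k => ?_
      have hmk : Measurable fun x : t → ℝ≥0∞ => expNeg (∑ s, (k s : ℝ≥0∞) * x s) :=
        expNeg_meas.comp (Finset.measurable_sum _ fun s _ => (measurable_pi_apply s).const_mul _)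
      rw [lintegral_map hmk hΦ, lintegral_map hmk hΦ]
      have := h (fun x => ∑ s : t, (k s : ℝ) * (s.1.1).indicator 1 x)
        (Finset.measurable_sum _ fun s _ => ((measurable_one.indicator s.1.2).const_mul _))
        (fun x => Finset.sum_nonneg fun s _ => mul_nonneg (by positivity)
          (Set.indicator_nonneg (fun _ _ => zero_le_one) _))
      have hp : ∀ ν : Measure X, pairing (fun x => ∑ s : t, (k s : ℝ) * (s.1.1).indicator 1 x) ν
          = ∑ s : t, (k s : ℝ≥0∞) * ν s.1.1 := by
        intro ν
        unfold pairing
        have : ∀ x, ENNReal.ofReal (∑ s : t, (k s : ℝ) * (s.1.1).indicator 1 x)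
            = ∑ s : t, (k s : ℝ≥0∞) * (s.1.1).indicator 1 x := by
          intro x
          rw [ENNReal.ofReal_sum_of_nonneg]
          · refine Finset.sum_congr rfl fun s _ => ?_
            rw [ENNReal.ofReal_mul (by positivity)]
            by_cases hx : x ∈ s.1.1 <;> simp [hx]
          · exact fun s _ => mul_nonneg (by positivity)
              (Set.indicator_nonneg (fun _ _ => zero_le_one) _)
        simp_rw [this]
        rw [lintegral_finsetSum]
        · refine Finset.sum_congr rfl fun s _ => ?_
          rw [lintegral_const_mul _ (measurable_one.indicator s.1.2), lintegral_indicator_one s.1.2]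
        · exact fun s _ => (measurable_one.indicator s.1.2).const_mul _
      unfold laplaceT at this
      simp_rw [hp] at this
      exact this
    rw [this]

end Unique

end PS8

namespace PS8

open Filter Topology

section Main

set_option linter.unusedSectionVars false

variable {X : Type*} [MeasurableSpace X] [MetricSpace X] [PolishSpace X] [BorelSpace X]

/-- The generating functional `s ↦ E ∏ (1 - s(x))`. -/
def HH (P : Measure (Measure X)) (s : X → ℝ) : ℝ≥0∞ :=
  ∫⁻ μ, expNeg (∫⁻ x, ENNReal.ofReal (-Real.log (1 - s x)) ∂μ) ∂P

theorem meas_pairing {f : X → ℝ} (hf : Measurable f) : Measurable (pairing f) :=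
  Measure.measurable_lintegral hf.ennreal_ofReal

theorem meas_expPair {f : X → ℝ} (hf : Measurable f) :
    Measurable fun ν : Measure X => expNeg (pairing f ν) := expNeg_meas.comp (meas_pairing hf)

theorem lintegral_moment (P : Measure (Measure X)) {f : X → ℝ≥0∞} (hf : Measurable f) :
    ∫⁻ x, f x ∂(momentMeasure P) = ∫⁻ μ, ∫⁻ x, f x ∂μ ∂P := by
  unfold momentMeasure
  rw [Measure.lintegral_bind aemeasurable_id hf.aemeasurable]; rfl

theorem laplace_bind {P : Measure (Measure X)} (hP : IsPointProcess P) {q : ℝ}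
    {T : Measure X → Measure (Measure X)} (hTm : Measurable T)
    (hT : ∀ μ, IsPointMeasure μ → IsThinning q μ (T μ)) {f : X → ℝ} (hf : MemU f) :
    laplaceT (P.bind T) f = HH P (fun x => q * (1 - Real.exp (-f x))) := by
  unfold laplaceT HH
  rw [Measure.lintegral_bind hTm.aemeasurable (meas_expPair hf.1).aemeasurable]
  refine lintegral_congr_ae ?_
  filter_upwards [hP.2] with μ hμ
  have := (hT μ hμ).2.2 f hf
  unfold laplaceT at this
  rw [this]
  congr 2
  ext x
  congr 3
  ring

theorem prob_bind {P : Measure (Measure X)} (hP : IsPointProcess P) {q : ℝ}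
    {T : Measure X → Measure (Measure X)} (hTm : Measurable T)
    (hT : ∀ μ, IsPointMeasure μ → IsThinning q μ (T μ)) : IsProbabilityMeasure (P.bind T) := by
  constructor
  have := hP.1
  rw [Measure.bind_apply MeasurableSet.univ hTm.aemeasurable]
  have : ∀ᵐ μ ∂P, T μ Set.univ = 1 := by
    filter_upwards [hP.2] with μ hμ
    have := (hT μ hμ).1
    simp
  rw [lintegral_congr_ae this]
  simp

theorem feq {P : Measure (Measure X)} (hP : IsPointProcess P) {q : ℝ}
    {T T' : Measure X → Measure (Measure X)} (hTm : Measurable T) (hT'm : Measurable T')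
    (hT : ∀ μ, IsPointMeasure μ → IsThinning q μ (T μ))
    (hT' : ∀ μ, IsPointMeasure μ → IsThinning (1 - q) μ (T' μ))
    {S : Measure (Measure X × Measure X)}
    (hS : ∀ h : Measure X × Measure X → ℝ≥0∞, Measurable h →
      ∫⁻ p, h p ∂S = ∫⁻ μ, ∫⁻ ν, h (ν, μ - ν) ∂(T μ) ∂P)
    (hfact : S = (P.bind T).prod (P.bind T')) {f g : X → ℝ} (hf : MemU f) (hg : MemU g) :
    laplaceT (P.bind T) (fun x => f x + g x) * laplaceT (P.bind T') g =
      ∫⁻ μ, expNeg (pairing g μ) *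
        expNeg (∫⁻ x, ENNReal.ofReal (-Real.log (1 - q + q * Real.exp (-f x))) ∂μ) ∂P := by
  have := prob_bind hP hTm hT
  have := prob_bind hP hT'm hT'
  have hfg : Measurable fun x => f x + g x := hf.1.add hg.1
  have h1 := hS (fun p => expNeg (pairing (fun x => f x + g x) p.1) * expNeg (pairing g p.2))
    (((meas_expPair hfg).comp measurable_fst).mul ((meas_expPair hg.1).comp measurable_snd))
  rw [hfact, lintegral_prod_mul (meas_expPair hfg).aemeasurable
    (meas_expPair hg.1).aemeasurable] at h1
  unfold laplaceT
  rw [h1]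
  refine lintegral_congr_ae ?_
  filter_upwards [hP.2] with μ hμ
  have hth := hT μ hμ
  have h2 : ∀ᵐ ν ∂(T μ), expNeg (pairing (fun x => f x + g x) ν) * expNeg (pairing g (μ - ν))
      = expNeg (pairing g μ) * expNeg (pairing f ν) := by
    filter_upwards [hth.2.1] with ν hν
    have := hν.1.2
    have hadd : pairing (fun x => f x + g x) ν = pairing f ν + pairing g ν := by
      unfold pairing
      rw [← lintegral_add_left hf.1.ennreal_ofReal]
      exact lintegral_congr fun x => ENNReal.ofReal_add (hf.2.1 x) (hg.2.1 x)
    have hμg : pairing g μ = pairing g ν + pairing g (μ - ν) := by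
      unfold pairing
      rw [← lintegral_add_measure, add_sub_of_le hν.2]
    rw [hadd, hμg, expNeg_add, expNeg_add]
    ring
  rw [lintegral_congr_ae h2, lintegral_const_mul _ (meas_expPair hf.1)]
  congr 1
  exact hth.2.2 f hf

theorem Hadd {P : Measure (Measure X)} (hP : IsPointProcess P) {q : ℝ}
    (hq : q ∈ Set.Ioo (0 : ℝ) 1)
    {T T' : Measure X → Measure (Measure X)} (hTm : Measurable T) (hT'm : Measurable T')
    (hT : ∀ μ, IsPointMeasure μ → IsThinning q μ (T μ))
    (hT' : ∀ μ, IsPointMeasure μ → IsThinning (1 - q) μ (T' μ))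
    {S : Measure (Measure X × Measure X)}
    (hS : ∀ h : Measure X × Measure X → ℝ≥0∞, Measurable h →
      ∫⁻ p, h p ∂S = ∫⁻ μ, ∫⁻ ν, h (ν, μ - ν) ∂(T μ) ∂P)
    (hfact : S = (P.bind T).prod (P.bind T'))
    {w : X → ℝ} (hw : Measurable w) (hw0 : ∀ x, 0 ≤ w x)
    (hwb : Bornology.IsBounded (Function.support w)) {k θ : ℝ} (hθ : θ < 1)
    (hkw : ∀ x, k * w x ≤ q * θ) (hk : q ≤ k * (1 - q)) :
    HH P (fun x => (k + 1) * w x) = HH P (fun x => k * w x) * HH P w := by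
  obtain ⟨hq0, hq1⟩ := hq
  have hq1' : 0 < 1 - q := by linarith
  have hk0 : 0 < k := by
    by_contra h
    nlinarith
  set ψ : X → ℝ := fun x => 1 - w x / (1 - q) with hψ
  set χ : X → ℝ := fun x => 1 - k * w x / q with hχ
  have hwk : ∀ x, w x / (1 - q) ≤ k * w x / q := by
    intro x
    rw [div_le_div_iff₀ hq1' hq0]
    nlinarith [hw0 x]
  have hkq : ∀ x, k * w x / q ≤ θ := by
    intro x
    rw [div_le_iff₀ hq0]; linarith [hkw x]
  have hχl : ∀ x, 1 - θ ≤ χ x := fun x => by simp only [hχ]; linarith [hkq x]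
  have hχψ : ∀ x, χ x ≤ ψ x := fun x => by simp only [hχ, hψ]; linarith [hwk x]
  have hψ1 : ∀ x, ψ x ≤ 1 := fun x => by
    have := div_nonneg (hw0 x) hq1'.le
    simp only [hψ]; linarith
  have hχ0 : ∀ x, 0 < χ x := fun x => by linarith [hχl x]
  have hψ0 : ∀ x, 0 < ψ x := fun x => by linarith [hχ0 x, hχψ x]
  have hχm : Measurable χ := by fun_prop
  have hψm : Measurable ψ := by fun_prop
  have hlog1 : ∀ x, Real.log (1 - θ) ≤ Real.log (χ x) := fun x =>
    Real.log_le_log (by linarith) (hχl x)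
  have hlog2 : ∀ x, Real.log (χ x) ≤ Real.log (ψ x) := fun x =>
    Real.log_le_log (hχ0 x) (hχψ x)
  have hlog3 : ∀ x, Real.log (ψ x) ≤ 0 := fun x => Real.log_nonpos (hψ0 x).le (hψ1 x)
  set g : X → ℝ := fun x => -Real.log (ψ x) with hg
  set f : X → ℝ := fun x => Real.log (ψ x) - Real.log (χ x) with hf
  have hgU : MemU g := by
    refine ⟨by fun_prop, fun x => by simp only [hg]; linarith [hlog3 x],
      ⟨-Real.log (1 - θ), fun x => by simp only [hg]; linarith [hlog1 x, hlog2 x]⟩,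
      hwb.subset ?_⟩
    intro x hx hx0
    exact hx (by simp [hg, hψ, hx0])
  have hfU : MemU f := by
    refine ⟨by fun_prop, fun x => by simp only [hf]; linarith [hlog2 x],
      ⟨-Real.log (1 - θ), fun x => by simp only [hf]; linarith [hlog1 x, hlog3 x]⟩,
      hwb.subset ?_⟩
    intro x hx hx0
    exact hx (by simp [hf, hψ, hχ, hx0])
  have hfgU : MemU fun x => f x + g x := by
    refine ⟨by fun_prop, fun x => add_nonneg (hfU.2.1 x) (hgU.2.1 x),
      ⟨-Real.log (1 - θ), fun x => by simp only [hf, hg]; linarith [hlog1 x]⟩,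
      hwb.subset ?_⟩
    intro x hx hx0
    exact hx (by simp [hf, hg, hψ, hχ, hx0])
  have main := feq hP hTm hT'm hT hT' hS hfact hfU hgU
  rw [laplace_bind hP hTm hT hfgU, laplace_bind hP hT'm hT' hgU] at main
  have e1 : (fun x => q * (1 - Real.exp (-(f x + g x)))) = fun x => k * w x := by
    ext x
    have : -(f x + g x) = Real.log (χ x) := by simp only [hf, hg]; ring
    rw [this, Real.exp_log (hχ0 x)]
    simp only [hχ]; field_simp; ring
  have e2 : (fun x => (1 - q) * (1 - Real.exp (-g x))) = w := by
    ext x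
    have : -g x = Real.log (ψ x) := by simp only [hg]; ring
    rw [this, Real.exp_log (hψ0 x)]
    simp only [hψ]; field_simp; ring
  rw [e1, e2] at main
  rw [main]
  unfold HH
  refine lintegral_congr fun μ => ?_
  rw [← expNeg_add]
  unfold pairing
  rw [← lintegral_add_left hgU.1.ennreal_ofReal]
  congr 1
  refine lintegral_congr fun x => ?_
  have hexp : Real.exp (-f x) = χ x / ψ x := by
    have : -f x = Real.log (χ x) - Real.log (ψ x) := by simp only [hf]; ring
    rw [this, Real.exp_sub, Real.exp_log (hχ0 x), Real.exp_log (hψ0 x)]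
  have hr0 : 0 ≤ χ x / ψ x := div_nonneg (hχ0 x).le (hψ0 x).le
  have hr1 : χ x / ψ x ≤ 1 := (div_le_one (hψ0 x)).2 (hχψ x)
  have hpos : 0 < 1 - q + q * (χ x / ψ x) := by positivity
  have hle : 1 - q + q * (χ x / ψ x) ≤ 1 := by nlinarith
  rw [hexp, ← ENNReal.ofReal_add (hgU.2.1 x)
    (neg_nonneg.2 (Real.log_nonpos hpos.le hle))]
  congr 1
  simp only [hg]
  rw [← neg_add, ← Real.log_mul (hψ0 x).ne' hpos.ne']
  congr 2
  have : ψ x * (1 - q + q * (χ x / ψ x)) = (1 - q) * ψ x + q * χ x := by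
    have := (hψ0 x).ne'
    field_simp
  rw [this]
  simp only [hψ, hχ]; field_simp; ring

theorem HH_le_one {P : Measure (Measure X)} [IsProbabilityMeasure P] (s : X → ℝ) :
    HH P s ≤ 1 := by
  unfold HH
  calc _ ≤ ∫⁻ _, 1 ∂P := lintegral_mono fun μ => expNeg_le_one _
    _ = 1 := by simp

theorem Hlim {P : Measure (Measure X)} [IsProbabilityMeasure P] {s : X → ℝ} (hs : Measurable s)
    (hs0 : ∀ x, 0 ≤ s x) {b : ℝ} (hsb : ∀ x, s x ≤ b)
    (hfin : ∫⁻ x, ENNReal.ofReal (s x) ∂(momentMeasure P) ≠ ∞) :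
    Tendsto (fun n : ℕ => (n : ℝ≥0∞) * (1 - HH P (fun x => s x / n))) atTop
      (𝓝 (∫⁻ x, ENNReal.ofReal (s x) ∂(momentMeasure P))) := by
  have hsm := hs.ennreal_ofReal
  have hm : ∀ n : ℕ, Measurable fun x => ENNReal.ofReal (-Real.log (1 - s x / n)) := by
    intro n; fun_prop
  have hcm : ∀ n : ℕ, Measurable fun μ : Measure X =>
      ∫⁻ x, ENNReal.ofReal (-Real.log (1 - s x / n)) ∂μ := fun n =>
    Measure.measurable_lintegral (hm n)
  rw [lintegral_moment P hsm] at hfin ⊢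
  have hnb : ∀ᶠ n : ℕ in atTop, ∀ x, (n : ℝ≥0∞) * ENNReal.ofReal (-Real.log (1 - s x / n))
      ≤ 2 * ENNReal.ofReal (s x) := by
    have h1 : ∀ᶠ n : ℕ in atTop, 2 * b ≤ (n : ℝ) :=
      tendsto_natCast_atTop_atTop.eventually_ge_atTop _
    filter_upwards [h1, eventually_gt_atTop 0] with n hn hn0 x
    have hn0' : (0 : ℝ) < n := by positivity
    have hy : s x / n ≤ 1 / 2 := by
      rw [div_le_div_iff₀ hn0' two_pos]; linarith [hsb x]
    have hy0 : 0 ≤ s x / n := div_nonneg (hs0 x) hn0'.le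
    have h2 : -Real.log (1 - s x / n) ≤ 2 * (s x / n) := by
      have h3 := Real.one_sub_inv_le_log_of_pos (x := 1 - s x / n) (by linarith)
      have h4 : (1 - s x / n)⁻¹ ≤ 1 + 2 * (s x / n) := by
        rw [inv_le_iff_one_le_mul₀ (by linarith)]
        nlinarith
      linarith
    rw [← ENNReal.ofReal_natCast, ← ENNReal.ofReal_mul hn0'.le]
    have h5 : (2 : ℝ≥0∞) = ENNReal.ofReal 2 := by simp
    rw [h5, ← ENNReal.ofReal_mul two_pos.le]
    apply ENNReal.ofReal_le_ofReal
    calc (n : ℝ) * -Real.log (1 - s x / n) ≤ n * (2 * (s x / n)) := by gcongr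
      _ = 2 * s x := by field_simp
  have hpt : ∀ x, Tendsto (fun n : ℕ => (n : ℝ≥0∞) * ENNReal.ofReal (-Real.log (1 - s x / n)))
      atTop (𝓝 (ENNReal.ofReal (s x))) := by
    intro x
    have h1 := ((Real.tendsto_mul_log_one_add_div_atTop (-s x)).comp
      tendsto_natCast_atTop_atTop).neg
    rw [neg_neg] at h1
    refine (ENNReal.tendsto_ofReal h1).congr fun n => ?_
    rw [← ENNReal.ofReal_natCast, ← ENNReal.ofReal_mul (by positivity)]
    congr 1
    simp only [Function.comp]
    rw [mul_neg, neg_div, ← sub_eq_add_neg]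
  have heq : ∀ n : ℕ, (n : ℝ≥0∞) * (1 - HH P (fun x => s x / n)) =
      ∫⁻ μ, (n : ℝ≥0∞) * (1 - expNeg (∫⁻ x, ENNReal.ofReal (-Real.log (1 - s x / n)) ∂μ)) ∂P := by
    intro n
    have hmn : Measurable fun μ : Measure X =>
      expNeg (∫⁻ x, ENNReal.ofReal (-Real.log (1 - s x / n)) ∂μ) := expNeg_meas.comp (hcm n)
    have hsubm : Measurable fun μ : Measure X =>
      1 - expNeg (∫⁻ x, ENNReal.ofReal (-Real.log (1 - s x / n)) ∂μ) := measurable_const.sub hmn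
    rw [lintegral_const_mul _ hsubm]
    congr 1
    rw [lintegral_sub hmn (ne_top_of_le_ne_top one_ne_top (HH_le_one (P := P) fun x => s x / n))
      (Eventually.of_forall fun μ => expNeg_le_one _)]
    simp [HH]
  simp_rw [heq]
  refine tendsto_lintegral_filter_of_dominated_convergence
    (fun μ => 2 * ∫⁻ x, ENNReal.ofReal (s x) ∂μ) ?_ ?_ ?_ ?_
  · exact Eventually.of_forall fun n => ((measurable_const.sub
      (expNeg_meas.comp (hcm n))).const_mul _)
  · filter_upwards [hnb] with n hn
    refine Eventually.of_forall fun μ => ?_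
    calc _ ≤ (n : ℝ≥0∞) * ∫⁻ x, ENNReal.ofReal (-Real.log (1 - s x / n)) ∂μ := by
          gcongr; exact one_sub_expNeg_le _
      _ = ∫⁻ x, n * ENNReal.ofReal (-Real.log (1 - s x / n)) ∂μ :=
          (lintegral_const_mul _ (hm n)).symm
      _ ≤ ∫⁻ x, 2 * ENNReal.ofReal (s x) ∂μ := lintegral_mono hn
      _ = _ := lintegral_const_mul _ hsm
  · rw [lintegral_const_mul _ (Measure.measurable_lintegral hsm)]
    exact ENNReal.mul_ne_top (by simp) hfin
  · filter_upwards [ae_lt_top (Measure.measurable_lintegral hsm) hfin] with μ hμ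
    refine tendsto_mul_one_sub hμ.ne ?_
    simp_rw [← lintegral_const_mul _ (hm _)]
    refine tendsto_lintegral_filter_of_dominated_convergence
      (fun x => 2 * ENNReal.ofReal (s x)) ?_ ?_ ?_ ?_
    · exact Eventually.of_forall fun n => (hm n).const_mul _
    · filter_upwards [hnb] with n hn using Eventually.of_forall hn
    · rw [lintegral_const_mul _ hsm]
      exact ENNReal.mul_ne_top (by simp) hμ.ne
    · exact Eventually.of_forall hpt

end Main

end PS8

namespace PS8

open Filter Topology

section Main2

set_option linter.unusedSectionVars false

variable {X : Type*} [MeasurableSpace X] [MetricSpace X] [PolishSpace X] [BorelSpace X]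

theorem tendsto_one_of {a : ℕ → ℝ≥0∞} {l : ℝ≥0∞} (hl : l ≠ ∞) (ha : ∀ n, a n ≤ 1)
    (h : Tendsto (fun n : ℕ => (n : ℝ≥0∞) * (1 - a n)) atTop (𝓝 l)) :
    Tendsto a atTop (𝓝 1) := by
  have h1 : Tendsto (fun n : ℕ => (n : ℝ≥0∞) * (1 - a n) / n) atTop (𝓝 (l / ∞)) :=
    ENNReal.Tendsto.div h (Or.inr (by simp)) ENNReal.tendsto_nat_nhds_top (Or.inr hl)
  rw [ENNReal.div_top] at h1
  have h2 : Tendsto (fun n : ℕ => 1 - a n) atTop (𝓝 0) := by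
    refine h1.congr' ?_
    filter_upwards [eventually_gt_atTop 0] with n hn
    rw [mul_comm]
    exact ENNReal.mul_div_cancel_right (by simpa using hn.ne') (by simp)
  have h3 := ENNReal.Tendsto.sub (tendsto_const_nhds (x := (1 : ℝ≥0∞)) (f := atTop)) h2
    (Or.inl one_ne_top)
  rw [tsub_zero] at h3
  exact h3.congr fun n => ENNReal.sub_sub_cancel one_ne_top (ha n)

theorem LapFin {P : Measure (Measure X)} [IsProbabilityMeasure P] {q : ℝ}
    (hq : q ∈ Set.Ioo (0 : ℝ) 1)
    (hadd : ∀ w : X → ℝ, Measurable w → (∀ x, 0 ≤ w x) →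
      Bornology.IsBounded (Function.support w) → ∀ k θ : ℝ, θ < 1 →
      (∀ x, k * w x ≤ q * θ) → q ≤ k * (1 - q) →
      HH P (fun x => (k + 1) * w x) = HH P (fun x => k * w x) * HH P w)
    {f : X → ℝ} (hf : MemU f) (hfin : ∫⁻ x, ENNReal.ofReal (f x) ∂(momentMeasure P) ≠ ∞) :
    HH P (fun x => q * (1 - Real.exp (-f x))) =
      expNeg (∫⁻ x, ENNReal.ofReal (1 - Real.exp (-f x)) ∂(ENNReal.ofReal q • momentMeasure P)) := by
  obtain ⟨hq0, hq1⟩ := hq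
  have hq1' : 0 < 1 - q := by linarith
  obtain ⟨hfm, hf0, ⟨C, hC⟩, hfb⟩ := hf
  set s : X → ℝ := fun x => q * (1 - Real.exp (-f x)) with hs
  have hsm : Measurable s := by fun_prop
  have hexp1 : ∀ x, Real.exp (-f x) ≤ 1 := fun x => Real.exp_le_one_iff.2 (by linarith [hf0 x])
  have hs0 : ∀ x, 0 ≤ s x := fun x => mul_nonneg hq0.le (by linarith [hexp1 x])
  set θ : ℝ := 1 - Real.exp (-C) with hθ
  have hθ1 : θ < 1 := by linarith [Real.exp_pos (-C)]
  have hsθ : ∀ x, s x ≤ q * θ := fun x => by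
    have : Real.exp (-C) ≤ Real.exp (-f x) := Real.exp_le_exp.2 (by linarith [hC x])
    simp only [hs, hθ]; gcongr
  have hsb : Bornology.IsBounded (Function.support s) := by
    refine hfb.subset fun x hx hx0 => hx ?_
    simp [hs, hx0]
  have hsf : ∀ x, s x ≤ f x := fun x => by
    have := Real.add_one_le_exp (-f x)
    simp only [hs]
    nlinarith [hexp1 x]
  obtain ⟨K, hK⟩ := exists_nat_ge (q / (1 - q))
  rw [div_le_iff₀ hq1'] at hK
  set I := ∫⁻ x, ENNReal.ofReal (s x) ∂(momentMeasure P) with hI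
  have hIfin : I ≠ ∞ := ne_top_of_le_ne_top hfin
    (lintegral_mono fun x => ENNReal.ofReal_le_ofReal (hsf x))
  have hIeq : ∫⁻ x, ENNReal.ofReal (1 - Real.exp (-f x)) ∂(ENNReal.ofReal q • momentMeasure P)
      = I := by
    rw [lintegral_smul_measure, smul_eq_mul, ← lintegral_const_mul _ (by fun_prop)]
    exact lintegral_congr fun x => (ENNReal.ofReal_mul hq0.le).symm
  rw [hIeq]
  have hstep : ∀ n : ℕ, 0 < n → ∀ j : ℕ, K + j ≤ n →
      HH P (fun x => ((K : ℝ) + j) * (s x / n)) =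
        HH P (fun x => (K : ℝ) * s x / n) * HH P (fun x => s x / n) ^ j := by
    intro n hn j
    have hn' : (0 : ℝ) < n := by positivity
    induction j with
    | zero => intro _; simp [mul_div_assoc]
    | succ j ih =>
      intro hj
      have h1 := hadd (fun x => s x / n) (hsm.div_const _) (fun x => div_nonneg (hs0 x) hn'.le)
        (hsb.subset fun x hx hx0 => hx (by simp [hx0])) (K + j) θ hθ1 ?_ ?_
      · rw [pow_succ, ← mul_assoc, ← ih (by omega), ← h1]
        congr 1
        ext x
        push_cast
        ring
      · intro x
        have h2 : ((K : ℝ) + j) ≤ n := by exact_mod_cast (by omega : K + j ≤ n)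
        calc ((K : ℝ) + j) * (s x / n) ≤ n * (s x / n) := by
              have := div_nonneg (hs0 x) hn'.le
              gcongr
          _ = s x := by field_simp
          _ ≤ _ := hsθ x
      · have : (0 : ℝ) ≤ j := by positivity
        nlinarith
  have hfun : ∀ n : ℕ, 0 < n → K ≤ n → HH P s * HH P (fun x => s x / n) ^ K =
      HH P (fun x => (K : ℝ) * s x / n) * HH P (fun x => s x / n) ^ n := by
    intro n hn hKn
    have hn' : (0 : ℝ) < n := by positivity
    have h1 := hstep n hn (n - K) (by omega)
    have h2 : (fun x => ((K : ℝ) + (n - K : ℕ)) * (s x / n)) = s := by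
      ext x
      rw [Nat.cast_sub hKn]
      field_simp
      ring
    rw [h2] at h1
    rw [h1, mul_assoc, ← pow_add]
    congr 2
    omega
  have hsle : ∀ x, s x ≤ q * θ := hsθ
  have l1 := Hlim (P := P) hsm hs0 hsθ hIfin
  have l2 : Tendsto (fun n : ℕ => HH P (fun x => s x / n)) atTop (𝓝 1) :=
    tendsto_one_of hIfin (fun n => HH_le_one _) l1
  have l3 : Tendsto (fun n : ℕ => HH P (fun x => s x / n) ^ n) atTop (𝓝 (expNeg I)) := by
    refine (tendsto_one_sub_pow hIfin (fun n => tsub_le_self) l1).congr fun n => ?_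
    rw [ENNReal.sub_sub_cancel one_ne_top (HH_le_one _)]
  have hKfin : ∫⁻ x, ENNReal.ofReal ((K : ℝ) * s x) ∂(momentMeasure P) ≠ ∞ := by
    have : ∀ x, ENNReal.ofReal ((K : ℝ) * s x) = (K : ℝ≥0∞) * ENNReal.ofReal (s x) := fun x => by
      rw [ENNReal.ofReal_mul (by positivity), ENNReal.ofReal_natCast]
    simp_rw [this]
    rw [lintegral_const_mul _ hsm.ennreal_ofReal]
    exact ENNReal.mul_ne_top (by simp) hIfin
  have l4 : Tendsto (fun n : ℕ => HH P (fun x => (K : ℝ) * s x / n)) atTop (𝓝 1) :=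
    tendsto_one_of hKfin (fun n => HH_le_one _)
      (Hlim (P := P) (s := fun x => (K : ℝ) * s x) (b := K * (q * θ)) (hsm.const_mul _)
        (fun x => mul_nonneg (by positivity) (hs0 x))
        (fun x => mul_le_mul_of_nonneg_left (hsθ x) (by positivity)) hKfin)
  have r1 : Tendsto (fun n : ℕ => HH P s * HH P (fun x => s x / n) ^ K) atTop (𝓝 (HH P s)) := by
    have := ENNReal.Tendsto.const_mul (a := HH P s) (((ENNReal.continuous_pow K).tendsto 1).comp l2) (Or.inl (by simp))
    simpa using this
  have r2 : Tendsto (fun n : ℕ => HH P (fun x => (K : ℝ) * s x / n) * HH P (fun x => s x / n) ^ n)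
      atTop (𝓝 (expNeg I)) := by
    have := ENNReal.Tendsto.mul l4 (Or.inl one_ne_zero) l3 (Or.inr one_ne_top)
    simpa using this
  refine tendsto_nhds_unique (r1.congr' ?_) r2
  filter_upwards [eventually_gt_atTop 0, eventually_ge_atTop K] with n h1 h2 using hfun n h1 h2

theorem exists_exhaust (ρ : Measure X) [SigmaFinite ρ] : ∃ B : ℕ → Set X, Monotone B ∧
    (∀ n, MeasurableSet (B n)) ∧ (∀ n, Bornology.IsBounded (B n)) ∧ (∀ n, ρ (B n) ≠ ∞) ∧
    ∀ x, ∀ᶠ n in atTop, x ∈ B n := by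
  rcases isEmpty_or_nonempty X with h | ⟨⟨x₀⟩⟩
  · exact ⟨fun _ => ∅, fun _ _ _ => le_rfl, by simp, by simp, by simp, fun x => (h.false x).elim⟩
  · refine ⟨fun n => spanningSets ρ n ∩ Metric.closedBall x₀ n, ?_, ?_, ?_, ?_, ?_⟩
    · intro m n hmn
      exact Set.inter_subset_inter (monotone_spanningSets ρ hmn)
        (Metric.closedBall_subset_closedBall (by exact_mod_cast hmn))
    · exact fun n => (measurableSet_spanningSets ρ n).inter Metric.isClosed_closedBall.measurableSet
    · exact fun n => Metric.isBounded_closedBall.subset Set.inter_subset_right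
    · exact fun n => ((measure_mono Set.inter_subset_left).trans_lt
        (measure_spanningSets_lt_top ρ n)).ne
    · intro x
      filter_upwards [eventually_ge_atTop (spanningSetsIndex ρ x),
        tendsto_natCast_atTop_atTop.eventually_ge_atTop (dist x x₀)] with n h1 h2
      exact ⟨monotone_spanningSets ρ h1 (mem_spanningSetsIndex ρ x), h2⟩

theorem LapAll {Q : Measure (Measure X)} [IsProbabilityMeasure Q] {ν ρ : Measure X} [SigmaFinite ν]
    (h : ∀ f : X → ℝ, MemU f → ∫⁻ x, ENNReal.ofReal (f x) ∂ν ≠ ∞ →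
      laplaceT Q f = expNeg (∫⁻ x, ENNReal.ofReal (1 - Real.exp (-f x)) ∂ρ))
    {f : X → ℝ} (hf : Measurable f) (hf0 : ∀ x, 0 ≤ f x) :
    laplaceT Q f = expNeg (∫⁻ x, ENNReal.ofReal (1 - Real.exp (-f x)) ∂ρ) := by
  obtain ⟨B, hBm, hBmeas, hBb, hBfin, hBex⟩ := exists_exhaust ν
  let F : ℕ → X → ℝ := fun n => (B n).indicator fun x => min (f x) n
  have hFm : ∀ n, Measurable (F n) := fun n =>
    (hf.min measurable_const).indicator (hBmeas n)
  have hmin0 : ∀ n : ℕ, ∀ x, 0 ≤ min (f x) n := fun n x => le_min (hf0 x) (by positivity)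
  have hF0 : ∀ n x, 0 ≤ F n x := fun n x => Set.indicator_nonneg (fun x _ => hmin0 n x) x
  have hFn : ∀ n x, F n x ≤ n := fun n x =>
    Set.indicator_le' (fun x _ => min_le_right _ _) (fun x _ => by positivity) x
  have hFU : ∀ n, MemU (F n) := fun n => ⟨hFm n, hF0 n, ⟨n, hFn n⟩,
    (hBb n).subset Set.support_indicator_subset⟩
  have hFmono : ∀ x, Monotone fun n => F n x := by
    intro x m n hmn
    by_cases hx : x ∈ B m
    · have hx' := hBm hmn hx
      simp only [F, Set.indicator_of_mem hx, Set.indicator_of_mem hx']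
      exact min_le_min le_rfl (by exact_mod_cast hmn)
    · have : F m x = 0 := Set.indicator_of_notMem hx _
      change F m x ≤ F n x
      rw [this]; exact hF0 n x
  have hFlim : ∀ x, Tendsto (fun n => F n x) atTop (𝓝 (f x)) := by
    intro x
    refine tendsto_const_nhds.congr' ?_
    filter_upwards [hBex x, tendsto_natCast_atTop_atTop.eventually_ge_atTop (f x)] with n h1 h2
    simp only [F, Set.indicator_of_mem h1, min_eq_left h2]
  have hFfin : ∀ n, ∫⁻ x, ENNReal.ofReal (F n x) ∂ν ≠ ∞ := by
    intro n
    refine ne_top_of_le_ne_top (b := ∫⁻ x, (B n).indicator (fun _ => (n : ℝ≥0∞)) x ∂ν) ?_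
      (lintegral_mono fun x => ?_)
    · rw [lintegral_indicator_const (hBmeas n)]
      exact ENNReal.mul_ne_top (by simp) (hBfin n)
    · by_cases hx : x ∈ B n
      · simp only [Set.indicator_of_mem hx]
        rw [← ENNReal.ofReal_natCast]
        exact ENNReal.ofReal_le_ofReal (hFn n x)
      · simp [F, hx]
  have l1 : Tendsto (fun n => laplaceT Q (F n)) atTop (𝓝 (laplaceT Q f)) := by
    refine tendsto_lintegral_of_dominated_convergence (fun _ => 1)
      (fun n => meas_expPair (hFm n)) (fun n => Eventually.of_forall fun μ => expNeg_le_one _)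
      (by simp) (Eventually.of_forall fun μ => ?_)
    refine (expNeg_cont.tendsto _).comp ?_
    refine lintegral_tendsto_of_tendsto_of_monotone
      (fun n => (hFm n).ennreal_ofReal.aemeasurable)
      (Eventually.of_forall fun x m n hmn => ENNReal.ofReal_le_ofReal (hFmono x hmn))
      (Eventually.of_forall fun x => ENNReal.tendsto_ofReal (hFlim x))
  have l2 : Tendsto (fun n => expNeg (∫⁻ x, ENNReal.ofReal (1 - Real.exp (-F n x)) ∂ρ)) atTop
      (𝓝 (expNeg (∫⁻ x, ENNReal.ofReal (1 - Real.exp (-f x)) ∂ρ))) := by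
    refine (expNeg_cont.tendsto _).comp ?_
    refine lintegral_tendsto_of_tendsto_of_monotone
      (fun n => ?_)
      (Eventually.of_forall fun x m n hmn => ENNReal.ofReal_le_ofReal ?_)
      (Eventually.of_forall fun x => ENNReal.tendsto_ofReal ?_)
    · have := hFm n
      fun_prop
    · have := Real.exp_le_exp.2 (neg_le_neg (hFmono x hmn))
      simp only at this
      linarith
    · exact tendsto_const_nhds.sub ((Real.continuous_exp.tendsto _).comp (hFlim x).neg)
  refine tendsto_nhds_unique l1 (l2.congr fun n => ?_)
  exact (h _ (hFU n) (hFfin n)).symm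

theorem mecke_exp {Q : Measure (Measure X)} [IsProbabilityMeasure Q] {ρ : Measure X}
    (h : ∀ f : X → ℝ, Measurable f → (∀ x, 0 ≤ f x) →
      laplaceT Q f = expNeg (∫⁻ x, ENNReal.ofReal (1 - Real.exp (-f x)) ∂ρ))
    {U : Set X} (hU : MeasurableSet U) (hUρ : ρ U ≠ ∞) (hUQ : ∫⁻ κ, κ U ∂Q ≠ ∞)
    {f : X → ℝ} (hf : Measurable f) (hf0 : ∀ x, 0 ≤ f x) :
    ∫⁻ κ, κ U * expNeg (pairing f κ) ∂Q =
      laplaceT Q f * ∫⁻ x in U, ENNReal.ofReal (Real.exp (-f x)) ∂ρ := by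
  have hUm := Measure.measurable_coe hU
  have hfE := meas_expPair hf
  -- left side
  have l1 : Tendsto (fun n : ℕ => ∫⁻ κ, ((n : ℝ≥0∞) * (1 - expNeg (κ U / n))) *
      expNeg (pairing f κ) ∂Q) atTop (𝓝 (∫⁻ κ, κ U * expNeg (pairing f κ) ∂Q)) := by
    refine tendsto_lintegral_filter_of_dominated_convergence (fun κ => κ U) ?_ ?_ hUQ ?_
    · exact Eventually.of_forall fun n => ((measurable_const.sub
        (expNeg_meas.comp (hUm.div_const _))).const_mul _).mul hfE
    · filter_upwards with n
      refine Eventually.of_forall fun κ => ?_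
      calc _ ≤ ((n : ℝ≥0∞) * (κ U / n)) * 1 := by
            gcongr
            · exact one_sub_expNeg_le _
            · exact expNeg_le_one _
        _ ≤ κ U := by rw [mul_one]; exact ENNReal.mul_div_le
    · filter_upwards [ae_lt_top hUm hUQ] with κ hκ
      refine ENNReal.Tendsto.mul_const (tendsto_mul_one_sub hκ.ne ?_) (Or.inr (expNeg_ne_top _))
      refine tendsto_const_nhds.congr' ?_
      filter_upwards [eventually_gt_atTop 0] with n hn
      exact (ENNReal.mul_div_cancel (by simpa using hn.ne') (by simp)).symm
  let c : ℕ → ℝ≥0∞ := fun n => ∫⁻ x in U, ENNReal.ofReal (Real.exp (-f x)) *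
    ENNReal.ofReal (1 - Real.exp (-(1 / n : ℝ))) ∂ρ
  have heE : Measurable fun x => ENNReal.ofReal (Real.exp (-f x)) := by fun_prop
  have hJle : ∫⁻ x in U, ENNReal.ofReal (Real.exp (-f x)) ∂ρ ≤ ρ U := by
    calc _ ≤ ∫⁻ x in U, 1 ∂ρ := lintegral_mono fun x => by
            rw [← ENNReal.ofReal_one]
            exact ENNReal.ofReal_le_ofReal (Real.exp_le_one_iff.2 (by linarith [hf0 x]))
      _ = ρ U := by simp
  have hJfin := ne_top_of_le_ne_top hUρ hJle
  have hstep : ∀ n : ℕ, 0 < n → ∫⁻ κ, ((n : ℝ≥0∞) * (1 - expNeg (κ U / n))) *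
      expNeg (pairing f κ) ∂Q = laplaceT Q f * (n * (1 - expNeg (c n))) := by
    intro n hn
    have hn' : (0 : ℝ) < n := by positivity
    let g : X → ℝ := fun x => f x + U.indicator (fun _ => (1 / n : ℝ)) x
    have hind : Measurable (U.indicator (fun _ : X => (1 / n : ℝ))) :=
      measurable_const.indicator hU
    have hind0 : ∀ x, 0 ≤ U.indicator (fun _ : X => (1 / n : ℝ)) x :=
      fun x => Set.indicator_nonneg (fun _ _ => by positivity) x
    have hgm : Measurable g := hf.add hind
    have hg0 : ∀ x, 0 ≤ g x := fun x => add_nonneg (hf0 x) (hind0 x)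
    have hgp : ∀ κ : Measure X, pairing g κ = pairing f κ + κ U / n := by
      intro κ
      unfold pairing
      simp only [g]
      simp_rw [fun x => ENNReal.ofReal_add (hf0 x) (hind0 x)]
      rw [lintegral_add_left hf.ennreal_ofReal]
      congr 1
      have : ∀ x, ENNReal.ofReal (U.indicator (fun _ : X => (1 / n : ℝ)) x)
          = U.indicator (fun _ => (n : ℝ≥0∞)⁻¹) x := by
        intro x
        by_cases hx : x ∈ U
        · simp only [Set.indicator_of_mem hx]
          rw [one_div, ENNReal.ofReal_inv_of_pos hn', ENNReal.ofReal_natCast]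
        · simp [hx]
      simp_rw [this]
      rw [lintegral_indicator_const hU, mul_comm, div_eq_mul_inv]
    have hLg : laplaceT Q g = laplaceT Q f * expNeg (c n) := by
      rw [h g hgm hg0, h f hf hf0, ← expNeg_add]
      congr 1
      simp only [c]
      rw [← lintegral_indicator hU, ← lintegral_add_left (by fun_prop)]
      refine lintegral_congr fun x => ?_
      by_cases hx : x ∈ U
      · simp only [g, Set.indicator_of_mem hx]
        have e1 : Real.exp (-f x) ≤ 1 := Real.exp_le_one_iff.2 (by linarith [hf0 x])
        have e2 : Real.exp (-(1 / n : ℝ)) ≤ 1 := Real.exp_le_one_iff.2 (by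
          have : (0 : ℝ) ≤ 1 / n := by positivity
          linarith)
        rw [← ENNReal.ofReal_mul (Real.exp_pos _).le, ← ENNReal.ofReal_add (by linarith)
          (mul_nonneg (Real.exp_pos _).le (by linarith)), neg_add, Real.exp_add]
        congr 1
        ring
      · simp [g, hx]
    have hlg : laplaceT Q g = ∫⁻ κ, expNeg (κ U / n) * expNeg (pairing f κ) ∂Q := by
      unfold laplaceT
      refine lintegral_congr fun κ => ?_
      rw [hgp, expNeg_add, mul_comm]
    have hLfin : laplaceT Q g ≠ ∞ := by
      refine ne_top_of_le_ne_top one_ne_top ?_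
      calc laplaceT Q g ≤ ∫⁻ _, 1 ∂Q := lintegral_mono fun κ => expNeg_le_one _
        _ = 1 := by simp
    have hmm : Measurable fun κ : Measure X => expNeg (κ U / n) * expNeg (pairing f κ) :=
      (expNeg_meas.comp (hUm.div_const _)).mul hfE
    have e : ∀ κ : Measure X, ((n : ℝ≥0∞) * (1 - expNeg (κ U / n))) * expNeg (pairing f κ) =
        n * (expNeg (pairing f κ) - expNeg (κ U / n) * expNeg (pairing f κ)) := by
      intro κ
      rw [mul_assoc, ENNReal.sub_mul (fun _ _ => expNeg_ne_top _), one_mul]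
    simp_rw [e]
    have hmm2 : Measurable fun κ : Measure X =>
      expNeg (pairing f κ) - expNeg (κ U / n) * expNeg (pairing f κ) := hfE.sub hmm
    rw [lintegral_const_mul _ hmm2, lintegral_sub hmm (by rw [← hlg]; exact hLfin)
      (Eventually.of_forall fun κ => 
        mul_le_of_le_one_left zero_le (expNeg_le_one _)), ← hlg, hLg]
    change (n : ℝ≥0∞) * (laplaceT Q f - laplaceT Q f * expNeg (c n)) = _
    have hLf : laplaceT Q f ≠ ∞ := by
      rw [h f hf hf0]; exact expNeg_ne_top _
    rw [mul_left_comm, ENNReal.mul_sub (fun _ _ => hLf), mul_one]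
  have l2 : Tendsto (fun n : ℕ => laplaceT Q f * (n * (1 - expNeg (c n)))) atTop
      (𝓝 (laplaceT Q f * ∫⁻ x in U, ENNReal.ofReal (Real.exp (-f x)) ∂ρ)) := by
    refine ENNReal.Tendsto.const_mul (tendsto_mul_one_sub hJfin ?_)
      (Or.inr (by rw [h f hf hf0]; exact expNeg_ne_top _))
    have hc : ∀ n : ℕ, (n : ℝ≥0∞) * c n = (∫⁻ x in U, ENNReal.ofReal (Real.exp (-f x)) ∂ρ) *
        (n * (1 - expNeg (1 / n))) := by
      intro n
      simp only [c]
      rw [lintegral_mul_const _ heE, mul_left_comm]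
      rcases Nat.eq_zero_or_pos n with rfl | hn
      · simp
      have hn' : (0 : ℝ) < n := by positivity
      have hne : (1 / n : ℝ≥0∞) ≠ ∞ := by
        simp [hn.ne']
      rw [expNeg_of_ne_top hne, ENNReal.ofReal_sub _ (Real.exp_pos _).le, ENNReal.ofReal_one]
      simp
    simp_rw [hc]
    have h1 : Tendsto (fun n : ℕ => (n : ℝ≥0∞) * (1 - expNeg (1 / n))) atTop (𝓝 1) := by
      refine tendsto_mul_one_sub one_ne_top (tendsto_const_nhds.congr' ?_)
      filter_upwards [eventually_gt_atTop 0] with n hn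
      exact (ENNReal.mul_div_cancel (by simpa using hn.ne') (by simp)).symm
    simpa using ENNReal.Tendsto.const_mul h1 (Or.inr hJfin)
  refine tendsto_nhds_unique (l1.congr' ?_) l2
  filter_upwards [eventually_gt_atTop 0] with n hn using hstep n hn

end Main2

end PS8

namespace PS8

open Filter Topology

section Main3

set_option linter.unusedSectionVars false

variable {X : Type*} [MeasurableSpace X] [MetricSpace X] [PolishSpace X] [BorelSpace X]

theorem meas_addDirac : Measurable fun p : Measure X × X => p.1 + Measure.dirac p.2 :=
  measurable_fst.add (Measure.measurable_dirac.comp measurable_snd)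

theorem pairing_add_dirac {f : X → ℝ} (hf : Measurable f) (κ : Measure X) (x : X) :
    pairing f (κ + Measure.dirac x) = pairing f κ + ENNReal.ofReal (f x) := by
  unfold pairing
  rw [lintegral_add_measure, lintegral_dirac' _ hf.ennreal_ofReal]

theorem mecke_meas {Q : Measure (Measure X)} [IsProbabilityMeasure Q] {ρ : Measure X}
    (h : ∀ f : X → ℝ, Measurable f → (∀ x, 0 ≤ f x) →
      laplaceT Q f = expNeg (∫⁻ x, ENNReal.ofReal (1 - Real.exp (-f x)) ∂ρ))
    {U : Set X} (hU : MeasurableSet U) (hUρ : ρ U ≠ ∞) (hUQ : ∫⁻ κ, κ U ∂Q ≠ ∞) :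
    Q.withDensity (fun κ => κ U) =
      (Q.prod (ρ.restrict U)).map (fun p : Measure X × X => p.1 + Measure.dirac p.2) := by
  have hUm := Measure.measurable_coe hU
  have : IsFiniteMeasure (Q.withDensity (fun κ : Measure X => κ U)) :=
    isFiniteMeasure_withDensity hUQ
  have : IsFiniteMeasure (ρ.restrict U) := ⟨by simpa using hUρ.lt_top⟩
  refine laplace_unique fun f hf hf0 => ?_
  have hfE := meas_expPair hf
  have heE : Measurable fun x => ENNReal.ofReal (Real.exp (-f x)) := by fun_prop
  unfold laplaceT
  have hcomp : Measurable fun p : Measure X × X =>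
      expNeg (pairing f (p.1 + Measure.dirac p.2)) := hfE.comp meas_addDirac
  rw [lintegral_withDensity_eq_lintegral_mul _ hUm hfE, lintegral_map hfE meas_addDirac,
    lintegral_prod _ hcomp.aemeasurable]
  simp only [Pi.mul_apply]
  rw [mecke_exp h hU hUρ hUQ hf hf0]
  unfold laplaceT
  rw [← lintegral_mul_const _ hfE]
  refine lintegral_congr fun κ => ?_
  rw [← lintegral_const_mul _ heE]
  refine lintegral_congr fun x => ?_
  rw [pairing_add_dirac hf, expNeg_add, expNeg_of_ne_top ofReal_ne_top,
    ENNReal.toReal_ofReal (hf0 x)]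

def KK (O : Set X) (hO : MeasurableSet O) : ProbabilityTheory.Kernel (Measure X) X where
  toFun κ := (κ O)⁻¹ • κ.restrict O
  measurable' := by
    refine Measure.measurable_of_measurable_coe _ fun s hs => ?_
    simp only [Measure.smul_apply, smul_eq_mul, Measure.restrict_apply hs]
    exact (Measure.measurable_coe hO).inv.mul (Measure.measurable_coe (hs.inter hO))

theorem KK_apply {O : Set X} (hO : MeasurableSet O) (κ : Measure X) :
    KK O hO κ = (κ O)⁻¹ • κ.restrict O := rfl

instance {O : Set X} (hO : MeasurableSet O) : ProbabilityTheory.IsFiniteKernel (KK O hO) := by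
  refine ⟨⟨1, one_lt_top, fun κ => ?_⟩⟩
  rw [KK_apply]
  simp only [Measure.smul_apply, smul_eq_mul, Measure.restrict_apply_univ]
  exact ENNReal.inv_mul_le_one _

theorem KK_smul {O : Set X} (hO : MeasurableSet O) {κ : Measure X} (h : κ O ≠ ∞) :
    κ O • KK O hO κ = κ.restrict O := by
  rw [KK_apply, smul_smul]
  by_cases h0 : κ O = 0
  · rw [Measure.restrict_eq_zero.2 h0]; simp
  · rw [ENNReal.mul_inv_cancel h0 h, one_smul]

theorem campbell_local {Q : Measure (Measure X)} [IsProbabilityMeasure Q] {ρ : Measure X}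
    (h : ∀ f : X → ℝ, Measurable f → (∀ x, 0 ≤ f x) →
      laplaceT Q f = expNeg (∫⁻ x, ENNReal.ofReal (1 - Real.exp (-f x)) ∂ρ))
    {O : Set X} (hO : MeasurableSet O) (hOρ : ρ O ≠ ∞) (hOQ : ∫⁻ κ, κ O ∂Q ≠ ∞)
    {g : X → Measure X → ℝ≥0∞} (hg : Measurable (Function.uncurry g)) :
    AEMeasurable (fun κ : Measure X => ∫⁻ x in O, g x κ ∂κ) Q ∧
    ∫⁻ κ, ∫⁻ x in O, g x κ ∂κ ∂Q = ∫⁻ κ, ∫⁻ x in O, g x (κ + Measure.dirac x) ∂ρ ∂Q := by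
  have hOm := Measure.measurable_coe hO
  have fin1 : IsFiniteMeasure (Q.withDensity (fun κ : Measure X => κ O)) :=
    isFiniteMeasure_withDensity hOQ
  have fin2 : IsFiniteMeasure (ρ.restrict O) := ⟨by simpa using hOρ.lt_top⟩
  have hΦ : Measurable fun p : Measure X × X => (p.1 + Measure.dirac p.2, p.2) :=
    meas_addDirac.prodMk measurable_snd
  have hae : ∀ᵐ κ ∂Q, κ O < ∞ := ae_lt_top hOm hOQ
  have key : (Q.withDensity (fun κ : Measure X => κ O)).compProd (KK O hO) =
      (Q.prod (ρ.restrict O)).map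
        (fun p : Measure X × X => (p.1 + Measure.dirac p.2, p.2)) := by
    refine Measure.ext_prod fun {E U} hE hU => ?_
    rw [Measure.compProd_apply_prod hE hU, Measure.map_apply hΦ (hE.prod hU),
      restrict_withDensity hE,
      lintegral_withDensity_eq_lintegral_mul _ hOm (ProbabilityTheory.Kernel.measurable_coe _ hU)]
    have e1 : ∫⁻ κ in E, ((fun κ : Measure X => κ O) * fun κ => KK O hO κ U) κ ∂Q =
        ∫⁻ κ in E, κ (U ∩ O) ∂Q := by
      refine lintegral_congr_ae (ae_restrict_of_ae ?_)
      filter_upwards [hae] with κ hκ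
      have := congrArg (fun m : Measure X => m U) (KK_smul hO hκ.ne)
      simpa [Measure.restrict_apply hU] using this
    rw [e1]
    have hUO := hU.inter hO
    have m := congrArg (fun m : Measure (Measure X) => m E) (mecke_meas h hUO
      (measure_ne_top_of_subset Set.inter_subset_right hOρ)
      (ne_top_of_le_ne_top hOQ (lintegral_mono fun κ => measure_mono Set.inter_subset_right)))
    rw [withDensity_apply _ hE, Measure.map_apply meas_addDirac hE] at m
    rw [m, ← Measure.restrict_restrict hU]
    have : Q.prod ((ρ.restrict O).restrict U) =
        (Q.prod (ρ.restrict O)).restrict (Set.univ ×ˢ U) := by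
      rw [← Measure.prod_restrict, Measure.restrict_univ]
    rw [this, Measure.restrict_apply (meas_addDirac hE)]
    congr 1
    ext p
    simp
  have hgs : Measurable fun p : Measure X × X => g p.2 p.1 := hg.comp measurable_swap
  have hin : Measurable fun κ : Measure X => ∫⁻ x, g x κ ∂(KK O hO κ) :=
    hgs.lintegral_kernel_prod_right' (κ := KK O hO)
  have hcg : (fun κ : Measure X => κ O * ∫⁻ x, g x κ ∂(KK O hO κ)) =ᵐ[Q]
      fun κ => ∫⁻ x in O, g x κ ∂κ := by
    filter_upwards [hae] with κ hκ
    rw [← KK_smul hO hκ.ne, lintegral_smul_measure, smul_eq_mul]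
  refine ⟨⟨_, hOm.mul hin, hcg.symm⟩, ?_⟩
  rw [← lintegral_congr_ae hcg]
  have hcomp : Measurable fun p : Measure X × X => g p.2 (p.1 + Measure.dirac p.2) :=
    hgs.comp hΦ
  have e2 := congrArg (fun m => ∫⁻ p, g p.2 p.1 ∂m) key
  rw [Measure.lintegral_compProd hgs, lintegral_map hgs hΦ,
    lintegral_prod _ hcomp.aemeasurable,
    lintegral_withDensity_eq_lintegral_mul _ hOm hin] at e2
  exact e2

theorem campbell_full {Q : Measure (Measure X)} [IsProbabilityMeasure Q] {ρ : Measure X}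
    (h : ∀ f : X → ℝ, Measurable f → (∀ x, 0 ≤ f x) →
      laplaceT Q f = expNeg (∫⁻ x, ENNReal.ofReal (1 - Real.exp (-f x)) ∂ρ))
    {O : ℕ → Set X} (hO : ∀ n, MeasurableSet (O n)) (hOρ : ∀ n, ρ (O n) ≠ ∞)
    (hOQ : ∀ n, ∫⁻ κ, κ (O n) ∂Q ≠ ∞) (hOU : ⋃ n, O n = Set.univ)
    {g : X → Measure X → ℝ≥0∞} (hg : Measurable (Function.uncurry g)) :
    ∫⁻ κ, ∫⁻ x, g x κ ∂κ ∂Q = ∫⁻ κ, ∫⁻ x, g x (κ + Measure.dirac x) ∂ρ ∂Q := by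
  let D := disjointed O
  have hD : ∀ n, MeasurableSet (D n) := fun n => MeasurableSet.disjointed hO n
  have hDO : ∀ n, D n ⊆ O n := disjointed_subset O
  have hDU : ⋃ n, D n = Set.univ := by rw [← hOU]; exact iUnion_disjointed
  have hDd : Pairwise (Function.onFun Disjoint D) := disjoint_disjointed O
  have hDρ : ∀ n, ρ (D n) ≠ ∞ := fun n => measure_ne_top_of_subset (hDO n) (hOρ n)
  have hDQ : ∀ n, ∫⁻ κ, κ (D n) ∂Q ≠ ∞ := fun n =>
    ne_top_of_le_ne_top (hOQ n) (lintegral_mono fun κ => measure_mono (hDO n))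
  have dec : ∀ (m : Measure X) (u : X → ℝ≥0∞), ∫⁻ x, u x ∂m = ∑' n, ∫⁻ x in D n, u x ∂m := by
    intro m u
    rw [← lintegral_iUnion hD hDd, hDU, setLIntegral_univ]
  have loc := fun n => campbell_local h (hD n) (hDρ n) (hDQ n) hg
  rw [lintegral_congr fun κ => dec κ (fun x => g x κ),
    lintegral_congr fun κ => dec ρ (fun x => g x (κ + Measure.dirac x)),
    lintegral_tsum fun n => (loc n).1, lintegral_tsum fun n => ?_]
  · exact tsum_congr fun n => (loc n).2
  · have fin2 : IsFiniteMeasure (ρ.restrict (D n)) := ⟨by simpa using (hDρ n).lt_top⟩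
    have : Measurable fun p : Measure X × X => g p.2 (p.1 + Measure.dirac p.2) :=
      hg.comp (measurable_snd.prodMk meas_addDirac)
    exact this.lintegral_prod_right'.aemeasurable

theorem mean_bind_le {P : Measure (Measure X)} (hP : IsPointProcess P) {q : ℝ}
    {T : Measure X → Measure (Measure X)} (hTm : Measurable T)
    (hT : ∀ μ, IsPointMeasure μ → IsThinning q μ (T μ)) {U : Set X} (hU : MeasurableSet U) :
    ∫⁻ κ, κ U ∂(P.bind T) ≤ momentMeasure P U := by
  rw [Measure.lintegral_bind hTm.aemeasurable (Measure.measurable_coe hU).aemeasurable]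
  unfold momentMeasure
  rw [Measure.bind_apply hU aemeasurable_id]
  refine lintegral_mono_ae ?_
  filter_upwards [hP.2] with μ hμ
  obtain ⟨h1, h2, -⟩ := hT μ hμ
  calc ∫⁻ κ, κ U ∂(T μ) ≤ ∫⁻ _, μ U ∂(T μ) := by
        refine lintegral_mono_ae ?_
        filter_upwards [h2] with κ hκ using hκ.2 U
    _ = μ U := by simp

theorem point_bind {P : Measure (Measure X)} (hP : IsPointProcess P) {q : ℝ}
    {T : Measure X → Measure (Measure X)} (hTm : Measurable T)
    (hT : ∀ μ, IsPointMeasure μ → IsThinning q μ (T μ))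
    {O : ℕ → Set X} (hO : ∀ n, IsOpen (O n)) (hOP : ∀ n, momentMeasure P (O n) ≠ ∞)
    (hOU : ⋃ n, O n = Set.univ) :
    ∀ᵐ κ ∂(P.bind T), IsPointMeasure κ := by
  let G : Set (Measure X) := (⋂ n, {κ | κ (O n) < ∞}) ∩
    ⋂ V ∈ TopologicalSpace.countableBasis X, {κ | κ V ∈ IntVal}
  have hbm : ∀ V ∈ TopologicalSpace.countableBasis X, MeasurableSet V := fun V hV =>
    (TopologicalSpace.isOpen_of_mem_countableBasis hV).measurableSet
  have hG : MeasurableSet G := by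
    refine (MeasurableSet.iInter fun n => ?_).inter
      (MeasurableSet.biInter (TopologicalSpace.countable_countableBasis X) fun V hV => ?_)
    · exact Measure.measurable_coe (hO n).measurableSet measurableSet_Iio
    · exact Measure.measurable_coe (hbm V hV) measurableSet_IntVal
  have hGp : ∀ κ ∈ G, IsPointMeasure κ := by
    rintro κ ⟨h1, h2⟩
    have : IsLocallyFiniteMeasure κ := ⟨fun x => by
      obtain ⟨n, hn⟩ := Set.mem_iUnion.1 (hOU ▸ Set.mem_univ x)
      exact ⟨O n, (hO n).mem_nhds hn, Set.mem_iInter.1 h1 n⟩⟩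
    exact point_of_intVal fun V hV => Set.mem_iInter₂.1 h2 V hV
  have h0 : (P.bind T) Gᶜ = 0 := by
    rw [Measure.bind_apply hG.compl hTm.aemeasurable]
    have : ∀ᵐ μ ∂P, ∀ n, μ (O n) < ∞ := by
      refine ae_all_iff.2 fun n => ae_lt_top (Measure.measurable_coe (hO n).measurableSet) ?_
      have := hOP n
      unfold momentMeasure at this
      rwa [Measure.bind_apply (hO n).measurableSet aemeasurable_id] at this
    refine (lintegral_congr_ae (g := fun _ => 0) ?_).trans (by simp)
    filter_upwards [hP.2, this] with μ hμ hfin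
    have h2 := (hT μ hμ).2.1
    have : ∀ᵐ κ ∂(T μ), κ ∈ G := by
      filter_upwards [h2] with κ hκ
      refine ⟨Set.mem_iInter.2 fun n => (hκ.2 _).trans_lt (hfin n),
        Set.mem_iInter₂.2 fun V hV => intVal_of_point hκ.1 (hbm V hV)⟩
    exact this
  have : ∀ᵐ κ ∂(P.bind T), κ ∈ G := h0
  filter_upwards [this] with κ hκ using hGp κ hκ

end Main3

end PS8


/-- If a first-order point process `P` satisfies the splitting factorization
`S_q(P) = Γ_q(P) ⊗ Γ_{1-q}(P)`, then the Campbell measure of `Γ_q(P)` satisfies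
`C_{Γ_q(P)}(h) = ∫ Γ_q(P)(dκ) ∫ h(x, κ+δ_x) q ν_P(dx)`, i.e. `Γ_q(P)` has the constant
Papangelou kernel `q ν_P`; consequently (by Mecke's characterization)
`Γ_q(P) = Π_{q ν_P}`. -/
theorem statement8 {X : Type*} [MeasurableSpace X] [MetricSpace X] [PolishSpace X]
    [BorelSpace X] (P : Measure (Measure X)) (hP : IsPointProcess P)
    (hP1 : IsFirstOrder P) (q : ℝ) (hq : q ∈ Set.Ioo (0 : ℝ) 1)
    (T T' : Measure X → Measure (Measure X)) (hTm : Measurable T) (hT'm : Measurable T')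
    (hT : ∀ μ, IsPointMeasure μ → IsThinning q μ (T μ))
    (hT' : ∀ μ, IsPointMeasure μ → IsThinning (1 - q) μ (T' μ))
    (S : Measure (Measure X × Measure X))
    (hS : ∀ h : Measure X × Measure X → ℝ≥0∞, Measurable h →
      ∫⁻ p, h p ∂S = ∫⁻ μ, ∫⁻ ν, h (ν, μ - ν) ∂(T μ) ∂P)
    (hfact : S = (P.bind T).prod (P.bind T')) :
    (∀ h : X → Measure X → ℝ≥0∞, Measurable (Function.uncurry h) →
      ∫⁻ κ, ∫⁻ x, h x κ ∂κ ∂(P.bind T)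
        = ∫⁻ κ, ∫⁻ x, h x (κ + Measure.dirac x)
            ∂(ENNReal.ofReal q • momentMeasure P) ∂(P.bind T))
      ∧ IsPoissonPP (ENNReal.ofReal q • momentMeasure P) (P.bind T) := by
  have hPp : IsProbabilityMeasure P := hP.1
  have hlf : IsLocallyFiniteMeasure (momentMeasure P) := hP1
  have hQ := PS8.prob_bind hP hTm hT
  let FS := (momentMeasure P).finiteSpanningSetsInOpen'
  have hOpen : ∀ n, IsOpen (FS.set n) := FS.set_mem
  have hfin : ∀ n, momentMeasure P (FS.set n) ≠ ∞ := fun n => (FS.finite n).ne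
  have hlap : ∀ f : X → ℝ, Measurable f → (∀ x, 0 ≤ f x) →
      laplaceT (P.bind T) f = expNeg (∫⁻ x, ENNReal.ofReal (1 - Real.exp (-f x))
        ∂(ENNReal.ofReal q • momentMeasure P)) := by
    intro f hf hf0
    refine PS8.LapAll (ν := momentMeasure P) (fun g hg hgf => ?_) hf hf0
    rw [PS8.laplace_bind hP hTm hT hg]
    exact PS8.LapFin hq (fun w hw hw0 hwb k θ hθ hkw hk =>
      PS8.Hadd hP hq hTm hT'm hT hT' hS hfact hw hw0 hwb hθ hkw hk) hg hgf
  refine ⟨fun h hh => ?_, hQ, PS8.point_bind hP hTm hT hOpen hfin FS.spanning, fun f hf =>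
    hlap f hf.1 hf.2.1⟩
  refine PS8.campbell_full hlap (fun n => (hOpen n).measurableSet) (fun n => ?_) (fun n => ?_)
    FS.spanning hh
  · rw [Measure.smul_apply, smul_eq_mul]
    exact ENNReal.mul_ne_top ENNReal.ofReal_ne_top (hfin n)
  · exact ne_top_of_le_ne_top (hfin n)
      (PS8.mean_bind_le hP hTm hT (hOpen n).measurableSet)
end
end
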